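/- arXiv:1804.02312 — 8 statements merged into one kernel-verified Lean document; each statement's English description precedes it below -/
import Mathlib

section
/- The language {aa} over the one-letter alphabet {a} is the Szilard language of some labeled flat splicing system of type (1, 1) whose initial set is finite; that is, {aa} ∈ SZLS^1_{1,FIN}. -/
/-- A flat splicing rule `⟨α | γ−δ | β⟩`. -/
structure FlatRule (A : Type) where
  /-- left handle α -/
  lf : List A
  /-- right handle β -/
  rt : List A
  /-- first letter γ of the inserted word (a word of length ≤ 1) -/
  ins1 : List A
  /-- last letter δ of the inserted word (a word of length ≤ 1) -/
  ins2 : List A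

/-- Application of a flat splicing rule: from `u = x·α·β·y` and `v = γ·z·δ` (with `|v| ≥ 1`)
produce `w = x·α·v·β·y`. -/
def FlatRule.Splice {A : Type} (r : FlatRule A) (u v w : List A) : Prop :=
  ∃ x y z : List A,
    u = x ++ r.lf ++ r.rt ++ y ∧
    v = r.ins1 ++ z ++ r.ins2 ∧ 1 ≤ v.length ∧
    w = x ++ r.lf ++ v ++ r.rt ++ y

/-- A labeled flat splicing system `(A, I, R, Lab)`; every rule carries a label word over `Λ`
(a single letter for Szilard/control labelings, possibly the empty word for λ-labelings). -/
structure LabeledFSS (A Λ : Type) where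
  I : Set (List A)
  R : Set (FlatRule A)
  lab : FlatRule A → List Λ
  finR : R.Finite
  insBound : ∀ r ∈ R, r.ins1.length ≤ 1 ∧ r.ins2.length ≤ 1

namespace LabeledFSS

variable {A Λ : Type} (S : LabeledFSS A Λ)

/-- Some rule of the system is applicable to the word `u` (together with some initial word). -/
def Applicable (u : List A) : Prop :=
  ∃ r ∈ S.R, ∃ v ∈ S.I, ∃ w, r.Splice u v w

/-- `S.Deriv x ls` : starting from initial words, the word `x` is derivable with label word `ls`. -/
inductive Deriv : List A → List Λ → Prop
  | start {x₀ y₀ x₁ : List A} {r : FlatRule A} :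
      x₀ ∈ S.I → y₀ ∈ S.I → r ∈ S.R → r.Splice x₀ y₀ x₁ → Deriv x₁ (S.lab r)
  | step {x y w : List A} {ls : List Λ} {r : FlatRule A} :
      Deriv x ls → y ∈ S.I → r ∈ S.R → r.Splice x y w → Deriv w (ls ++ S.lab r)

/-- The derivation language (Szilard language resp. control language) of the system:
label words of terminal derivations. -/
def derLang : Language Λ :=
  { ls | ∃ x : List A, S.Deriv x ls ∧ ¬ S.Applicable x }

/-- The system has type `(m, n)`: `m` is the maximum length of the handles `α, β`
and `n` is the maximum length of `γδ` over all rules. -/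
def HasType (m n : ℕ) : Prop :=
  (∀ r ∈ S.R, r.lf.length ≤ m ∧ r.rt.length ≤ m) ∧
  (∃ r ∈ S.R, r.lf.length = m ∨ r.rt.length = m) ∧
  (∀ r ∈ S.R, r.ins1.length + r.ins2.length ≤ n) ∧
  (∃ r ∈ S.R, r.ins1.length + r.ins2.length = n)

/-- Szilard labeling: each rule is labeled by a single letter, in a one-to-one manner. -/
def SzilardLabeled : Prop :=
  (∀ r ∈ S.R, (S.lab r).length = 1) ∧ Set.InjOn S.lab S.R

/-- Control labeling: each rule is labeled by a single letter
(distinct rules may share a label). -/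
def ControlLabeled : Prop :=
  ∀ r ∈ S.R, (S.lab r).length = 1

/-- λ-control labeling: each rule is labeled by a single letter or by the empty word. -/
def LambdaControlLabeled : Prop :=
  ∀ r ∈ S.R, (S.lab r).length ≤ 1

end LabeledFSS


/-- The rule `⟨0 | 2− | 1⟩`, inserting a word that begins with `2` between `0` and `1`. -/
def insertBetween : FlatRule (Fin 3) := ⟨[0], [1], [2], []⟩

/-- The system whose initial words are `0101` and `2` and whose only rule is `insertBetween`. -/
def insertTwo : LabeledFSS (Fin 3) Unit where
  I := {[0, 1, 0, 1], [2]}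
  R := {insertBetween}
  lab _ := [()]
  finR := Set.finite_singleton _
  insBound := by simp [insertBetween]

theorem insertTwo_splice {u v w : List (Fin 3)} {r : FlatRule (Fin 3)} (hv : v ∈ insertTwo.I)
    (hr : r ∈ insertTwo.R) (h : r.Splice u v w) :
    ∃ x y, u = x ++ 0 :: 1 :: y ∧ w = x ++ 0 :: 2 :: 1 :: y := by
  obtain rfl : r = insertBetween := hr
  obtain ⟨x, y, z, hu, hz, -, hw⟩ := h
  rcases hv with rfl | rfl
  · simp [insertBetween] at hz
  · exact ⟨x, y, by simpa [insertBetween] using hu, by simpa [insertBetween] using hw⟩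

theorem insertTwo_applicable (x y : List (Fin 3)) :
    insertTwo.Applicable (x ++ 0 :: 1 :: y) :=
  ⟨insertBetween, rfl, [2], .inr rfl, x ++ 0 :: 2 :: 1 :: y, x, y, [],
    by simp [insertBetween], rfl, le_rfl, by simp [insertBetween]⟩

theorem insertTwo_deriv {x : List (Fin 3)} {ls : List Unit} (h : insertTwo.Deriv x ls) :
    ((x = [0, 2, 1, 0, 1] ∨ x = [0, 1, 0, 2, 1]) ∧ ls = [()]) ∨
      (x = [0, 2, 1, 0, 2, 1] ∧ ls = [(), ()]) := by
  induction h with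
  | start hx hy hr hs =>
    obtain ⟨p, q, hu, rfl⟩ := insertTwo_splice hy hr hs
    refine .inl ⟨?_, rfl⟩
    rcases hx with rfl | rfl <;> simp [List.cons_eq_append_iff] at hu <;> grind
  | step hd hy hr hs ih =>
    obtain ⟨p, q, hu, rfl⟩ := insertTwo_splice hy hr hs
    rcases ih with ⟨rfl | rfl, rfl⟩ | ⟨rfl, rfl⟩
    · refine .inr ⟨?_, rfl⟩
      simp [List.cons_eq_append_iff] at hu
      grind
    · refine .inr ⟨?_, rfl⟩
      simp [List.cons_eq_append_iff] at hu
      grind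
    · exfalso
      simp [List.cons_eq_append_iff] at hu

/-- The language `{aa}` over a one-letter alphabet is the Szilard language of some
labeled flat splicing system of type `(1, 1)` with finite initial set. -/
theorem stmt0 :
    ∃ (A : Type) (_ : Finite A) (S : LabeledFSS A Unit),
      S.SzilardLabeled ∧ S.I.Finite ∧ S.HasType 1 1 ∧
      S.derLang = {[(), ()]} := by
  refine ⟨Fin 3, inferInstance, insertTwo, ⟨fun _ _ => rfl, ?_⟩, by simp [insertTwo], ?_, ?_⟩
  · intro r hr s hs _
    exact (Set.mem_singleton_iff.1 hr).trans (Set.mem_singleton_iff.1 hs).symm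
  · simp [LabeledFSS.HasType, insertTwo, insertBetween]
  · ext ls
    constructor
    · rintro ⟨x, hd, ht⟩
      rcases insertTwo_deriv hd with ⟨rfl | rfl, -⟩ | ⟨-, rfl⟩
      · exact (ht (insertTwo_applicable [0, 2, 1] [])).elim
      · exact (ht (insertTwo_applicable [] [0, 2, 1])).elim
      · rfl
    · rintro rfl
      refine ⟨[0, 2, 1, 0, 2, 1], ?_, ?_⟩
      · have h := LabeledFSS.Deriv.start (S := insertTwo) (x₀ := [0, 1, 0, 1]) (y₀ := [2])
          (.inl rfl) (.inr rfl) rfl ⟨[], [0, 1], [], rfl, rfl, le_rfl, rfl⟩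
        exact h.step (y := [2]) (.inr rfl) rfl ⟨[0, 2, 1], [], [], rfl, rfl, le_rfl, rfl⟩
      · rintro ⟨r, rfl, v, -, w, x, y, z, hu, -⟩
        simp [insertBetween, List.cons_eq_append_iff] at hu
end

section
/- The language {aⁿ : n ≥ 1} is the Szilard language of some labeled flat splicing system of type (1, 1) whose initial set is a regular language; that is, {aⁿ : n ≥ 1} ∈ SZLS^1_{1,REG}. -/
/-- The rule `⟨0 | −1 | 0⟩` over the alphabet `{0, 1}`, with `0 = false` and `1 = true`. -/
def zeroZeroRule : FlatRule Bool where
  lf := [false]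
  rt := [false]
  ins1 := []
  ins2 := [true]

/-- The system over `{0, 1}` with all words initial and the single rule `⟨0 | −1 | 0⟩`. -/
def zeroZeroSystem : LabeledFSS Bool Unit where
  I := Set.univ
  R := {zeroZeroRule}
  lab := fun _ => [()]
  finR := Set.finite_singleton _
  insBound := by simp [zeroZeroRule]

theorem zeroZeroRule_splice (z y : List Bool) :
    zeroZeroRule.Splice (false :: false :: y) (z ++ [true])
      (false :: (z ++ [true] ++ false :: y)) :=
  ⟨[], y, z, by simp [zeroZeroRule]⟩

theorem zeroZeroSystem_not_applicable {u : List Bool}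
    (hu : u.IsChain fun p q => p = true ∨ q = true) : ¬ zeroZeroSystem.Applicable u := by
  rintro ⟨r, rfl, v, -, w, x, y, z, rfl, -⟩
  simp [zeroZeroRule, List.isChain_append] at hu

theorem zeroZeroSystem_exists_deriv (k : ℕ) :
    ∃ y : List Bool, (false :: y).IsChain (fun p q => p = true ∨ q = true) ∧
      ∀ z : List Bool, zeroZeroSystem.Deriv (false :: (z ++ [true] ++ false :: y))
        (List.replicate (k + 1) ()) := by
  induction k with
  | zero =>
    exact ⟨[], by simp, fun z => .start (Set.mem_univ _) (Set.mem_univ _)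
      (Set.mem_singleton _) (zeroZeroRule_splice z [])⟩
  | succ k ih =>
    obtain ⟨y, hy, hd⟩ := ih
    refine ⟨true :: false :: y, by simp [hy], fun z => ?_⟩
    rw [List.replicate_succ']
    exact .step (hd [false]) (Set.mem_univ _) (Set.mem_singleton _) (zeroZeroRule_splice z _)

theorem LabeledFSS.Deriv.label_ne_nil {A Λ : Type} {S : LabeledFSS A Λ}
    (hS : S.ControlLabeled) {x : List A} {ls : List Λ} (h : S.Deriv x ls) : ls ≠ [] := by
  cases h with
  | start _ _ hr _ => exact List.ne_nil_of_length_pos (by simp [hS _ hr])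
  | step _ _ hr _ => exact List.ne_nil_of_length_pos (by simp [hS _ hr])

theorem Language.isRegular_univ {α : Type*} :
    Language.IsRegular (Set.univ : Language α) := by
  refine ⟨Unit, inferInstance, ⟨fun _ _ => (), (), Set.univ⟩, ?_⟩
  ext w
  exact ⟨fun _ => Set.mem_univ _, fun _ => Set.mem_univ _⟩

/-- The language `{aⁿ : n ≥ 1}` is the Szilard language of some labeled flat splicing
system of type `(1, 1)` whose initial set is a regular language. -/
theorem stmt2 :
    ∃ (A : Type) (_ : Finite A) (S : LabeledFSS A Unit),
      S.SzilardLabeled ∧ Language.IsRegular (S.I : Language A) ∧ S.HasType 1 1 ∧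
      S.derLang = { w : List Unit | ∃ k : ℕ, 1 ≤ k ∧ w = List.replicate k () } := by
  refine ⟨Bool, inferInstance, zeroZeroSystem, ⟨fun _ _ => rfl, ?_⟩,
    Language.isRegular_univ, ?_, ?_⟩
  · exact Set.injOn_singleton _ _
  · simp [LabeledFSS.HasType, zeroZeroSystem, zeroZeroRule]
  · ext w
    constructor
    · rintro ⟨x, hx, -⟩
      exact ⟨w.length, List.length_pos_iff.2 (hx.label_ne_nil fun _ _ => rfl),
        List.eq_replicate_iff.2 ⟨rfl, fun _ _ => rfl⟩⟩
    · rintro ⟨k, hk, rfl⟩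
      obtain ⟨k, rfl⟩ := Nat.exists_eq_add_of_le' hk
      obtain ⟨y, hy, hd⟩ := zeroZeroSystem_exists_deriv k
      exact ⟨_, hd [], zeroZeroSystem_not_applicable (by simp [hy])⟩
end

section
/- There exists a labeled flat splicing system of type (1, 1) with finite initial set whose Szilard language is regular but infinite (for example the language {aⁿc : n ≥ 0}); that is, SZLS^1_{1,FIN} ∩ (REG \ FIN) ≠ ∅. -/
/-- The single splicing rule `⟨0 | 0−λ | 1⟩` over the alphabet `{0, 1, 2}`. -/
def nestRule : FlatRule (Fin 3) := ⟨[0], [1], [0], []⟩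

/-- The system with initial words `01` and `02` whose only rule is `nestRule`. -/
def nestSystem : LabeledFSS (Fin 3) Unit where
  I := {[0, 1], [0, 2]}
  R := {nestRule}
  lab _ := [()]
  finR := Set.finite_singleton _
  insBound := by simp [nestRule]

theorem nestSystem_deriv (n : ℕ) :
    nestSystem.Deriv (List.replicate n 0 ++ [0, 0, 1, 1] ++ List.replicate n 1)
      (List.replicate (n + 1) ()) := by
  induction n with
  | zero =>
    exact .start (S := nestSystem) (x₀ := [0, 1]) (y₀ := [0, 1]) (r := nestRule)
      (by simp [nestSystem]) (by simp [nestSystem]) rfl ⟨[], [], [1], by simp [nestRule]⟩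
  | succ n ih =>
    rw [List.replicate_succ' (n := n + 1)]
    refine .step (S := nestSystem) (y := [0, 1]) (r := nestRule) ih (by simp [nestSystem]) rfl
      ⟨List.replicate (n + 1) 0, List.replicate (n + 1) 1, [1], ?_⟩
    refine ⟨?_, by simp [nestRule], by simp, ?_⟩
    · simp [nestRule, List.replicate_succ' (n := n) (a := (0 : Fin 3)), List.replicate_succ]
    · simp [nestRule, List.replicate_succ' (n := n) (a := (0 : Fin 3)), List.replicate_succ]

theorem nestSystem_deriv_terminal (n : ℕ) :
    ∃ k m, nestSystem.Deriv (List.replicate k 0 ++ 2 :: List.replicate m 1)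
      (List.replicate (n + 1) ()) := by
  cases n with
  | zero =>
    exact ⟨2, 1, .start (S := nestSystem) (x₀ := [0, 1]) (y₀ := [0, 2]) (r := nestRule)
      (by simp [nestSystem]) (by simp [nestSystem]) rfl ⟨[], [], [2], by simp [nestRule]⟩⟩
  | succ n =>
    refine ⟨n + 1 + 1 + 1, n + 1 + 1, ?_⟩
    rw [List.replicate_succ' (n := n + 1) (a := ())]
    refine .step (S := nestSystem) (y := [0, 2]) (r := nestRule) (nestSystem_deriv n)
      (by simp [nestSystem]) rfl
      ⟨List.replicate (n + 1) 0, List.replicate (n + 1) 1, [2], ?_⟩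
    refine ⟨?_, by simp [nestRule], by simp, ?_⟩
    · simp [nestRule, List.replicate_succ' (n := n) (a := (0 : Fin 3)), List.replicate_succ]
    · simp [nestRule, List.replicate_succ' (a := (0 : Fin 3)), List.replicate_succ]

theorem replicate_append_ne (k m : ℕ) (x y : List (Fin 3)) :
    List.replicate k 0 ++ 2 :: List.replicate m 1 ≠ x ++ 0 :: 1 :: y := by
  induction k generalizing x with
  | zero =>
    intro h
    have h0 : (0 : Fin 3) ∈ x ++ 0 :: 1 :: y := by simp
    rw [← h] at h0
    simp [List.mem_replicate] at h0
  | succ k ih =>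
    intro h
    cases x with
    | nil => cases k <;> simp [List.replicate_succ] at h
    | cons a x =>
      simp only [List.replicate_succ, List.cons_append, List.cons.injEq] at h
      exact ih x h.2

theorem nestSystem_not_applicable (k m : ℕ) :
    ¬ nestSystem.Applicable (List.replicate k 0 ++ 2 :: List.replicate m 1) := by
  rintro ⟨r, rfl, v, -, w, x, y, z, h, -⟩
  exact replicate_append_ne k m x y (by simpa [nestRule] using h)

theorem isRegular_compl_singleton_nil {α : Type} :
    Language.IsRegular (({[]} : Set (List α))ᶜ : Set (List α)) := by
  refine ⟨Bool, inferInstance, ⟨fun _ _ => true, false, {true}⟩, ?_⟩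
  ext l
  rw [DFA.mem_accepts]
  refine Iff.trans ?_ Set.mem_compl_singleton_iff.symm
  induction l using List.reverseRecOn with
  | nil => simp
  | append_singleton l a _ => simp

theorem nestSystem_derLang : nestSystem.derLang = ({[]} : Set (List Unit))ᶜ := by
  ext ls
  constructor
  · rintro ⟨x, h, -⟩
    refine Set.mem_compl_singleton_iff.2 ?_
    cases h <;> simp [nestSystem]
  · intro h
    obtain ⟨n, hn⟩ := Nat.exists_eq_succ_of_ne_zero (mt List.length_eq_zero_iff.1 h)
    obtain ⟨k, m, hd⟩ := nestSystem_deriv_terminal n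
    have hls : ls = List.replicate (n + 1) () := List.eq_replicate_iff.2 ⟨hn, by simp⟩
    exact ⟨_, hls ▸ hd, nestSystem_not_applicable k m⟩

/-- There is a labeled flat splicing system of type `(1, 1)` with finite initial set whose
Szilard language is regular but infinite. -/
theorem stmt3 :
    ∃ (A Λ : Type) (_ : Finite A) (_ : Finite Λ) (S : LabeledFSS A Λ),
      S.SzilardLabeled ∧ S.I.Finite ∧ S.HasType 1 1 ∧
      Language.IsRegular S.derLang ∧ ¬ Set.Finite (S.derLang : Set (List Λ)) := by
  refine ⟨Fin 3, Unit, inferInstance, inferInstance, nestSystem, ?_, ?_, ?_, ?_, ?_⟩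
  · exact ⟨fun _ _ => rfl, Set.injOn_singleton _ _⟩
  · exact Set.toFinite {[0, 1], [0, 2]}
  · simp [LabeledFSS.HasType, nestSystem, nestRule]
  · rw [nestSystem_derLang]
    exact isRegular_compl_singleton_nil
  · rw [nestSystem_derLang]
    exact (Set.finite_singleton _).infinite_compl
end

section
/- There exists a labeled flat splicing system of type (2, 1) with finite initial set whose Szilard language is context-free but not regular (for example the language {aⁿ b cⁿ⁺¹ : n ≥ 1}); that is, SZLS^2_{1,FIN} ∩ (CF \ REG) ≠ ∅. -/
namespace FlatSplicing

/-- The word alphabet of the counting system. -/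
inductive Letter
  | left | tally | mark
  deriving DecidableEq

/-- The labels of the counting system. -/
inductive Label
  | grow | halt | consume
  deriving DecidableEq

open Letter Label

instance : Fintype Letter := ⟨{left, tally, mark}, by rintro ⟨⟩ <;> simp⟩

instance : Fintype Label := ⟨{grow, halt, consume}, by rintro ⟨⟩ <;> simp⟩

/-- Insert a tally right after the left end, in front of at least two tallies. -/
def growRule : FlatRule Letter := ⟨[left], [tally, tally], [tally], []⟩

/-- Insert a mark after the first tally of an unmarked word. -/
def haltRule : FlatRule Letter := ⟨[left, tally], [tally], [mark], []⟩

/-- Insert a mark after the first tally following a mark. -/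
def consumeRule : FlatRule Letter := ⟨[mark, tally], [tally], [mark], []⟩

/-- The system whose Szilard language is `{growⁿ halt consumeⁿ}`. -/
def countingSystem : LabeledFSS Letter Label where
  I := {[left, tally, tally], [tally], [mark]}
  R := {growRule, haltRule, consumeRule}
  lab r := if r.lf = [left] then [grow] else if r.lf = [left, tally] then [halt] else [consume]
  finR := by simp
  insBound := by simp [growRule, haltRule, consumeRule]

theorem lab_growRule : countingSystem.lab growRule = [grow] := rfl

theorem lab_haltRule : countingSystem.lab haltRule = [halt] := rfl

theorem lab_consumeRule : countingSystem.lab consumeRule = [consume] := rfl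

/-- The word `(tally mark)ᵏ tallyᵐ`. -/
def marked : ℕ → ℕ → List Letter
  | 0, m => List.replicate m tally
  | k + 1, m => tally :: mark :: marked k m

theorem left_notMem_marked (k m : ℕ) : left ∉ marked k m := by
  induction k with
  | zero => simp [marked]
  | succ k ih => simp [marked, ih]

theorem marked_eq_append_mark {k m : ℕ} {x y : List Letter}
    (h : marked k (m + 1) = x ++ mark :: tally :: tally :: y) :
    ∃ p, m = p + 1 ∧ x ++ mark :: tally :: mark :: tally :: y = marked (k + 1) (p + 1) ∧
      1 ≤ k := by
  induction k generalizing x with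
  | zero =>
    have : mark ∈ List.replicate (m + 1) tally := by
      rw [marked] at h; simp [h]
    simp at this
  | succ k ih =>
    match x with
    | [] => simp [marked] at h
    | [a] =>
      simp only [marked, List.cons_append, List.nil_append, List.cons.injEq, true_and] at h
      obtain ⟨rfl, h⟩ := h
      match k with
      | 0 =>
        match m with
        | 0 => simp [marked] at h
        | p + 1 => exact ⟨p, rfl, by simp_all [marked, List.replicate_succ], le_rfl⟩
      | k + 1 => simp [marked] at h
    | a :: b :: x =>
      simp only [marked, List.cons_append, List.cons.injEq] at h
      obtain ⟨rfl, rfl, h⟩ := h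
      obtain ⟨p, hp, h', -⟩ := ih h
      exact ⟨p, hp, by simp [marked, h'], by omega⟩

theorem eq_nil_of_left_cons_eq {u x y : List Letter} (hu : left ∉ u)
    (h : left :: u = x ++ left :: y) : x = [] ∧ u = y := by
  cases x with
  | nil => simpa using h
  | cons a x =>
    simp only [List.cons_append, List.cons.injEq] at h
    simp [h.2] at hu

theorem splice_growRule_iff {u v w : List Letter} (hv : v ∈ countingSystem.I) :
    growRule.Splice u v w ↔ v = [tally] ∧ ∃ x y, u = x ++ left :: tally :: tally :: y ∧
      w = x ++ left :: tally :: tally :: tally :: y := by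
  simp only [countingSystem, Set.mem_insert_iff, Set.mem_singleton_iff] at hv
  rcases hv with rfl | rfl | rfl <;> simp [FlatRule.Splice, growRule]

theorem splice_haltRule_iff {u v w : List Letter} (hv : v ∈ countingSystem.I) :
    haltRule.Splice u v w ↔ v = [mark] ∧ ∃ x y, u = x ++ left :: tally :: tally :: y ∧
      w = x ++ left :: tally :: mark :: tally :: y := by
  simp only [countingSystem, Set.mem_insert_iff, Set.mem_singleton_iff] at hv
  rcases hv with rfl | rfl | rfl <;> simp [FlatRule.Splice, haltRule]

theorem splice_consumeRule_iff {u v w : List Letter} (hv : v ∈ countingSystem.I) :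
    consumeRule.Splice u v w ↔ v = [mark] ∧ ∃ x y, u = x ++ mark :: tally :: tally :: y ∧
      w = x ++ mark :: tally :: mark :: tally :: y := by
  simp only [countingSystem, Set.mem_insert_iff, Set.mem_singleton_iff] at hv
  rcases hv with rfl | rfl | rfl <;> simp [FlatRule.Splice, consumeRule]

/-- The configurations (word, label word) reachable from `left tally tally`. -/
inductive Config : List Letter → List Label → Prop
  | growing (n : ℕ) : Config (left :: marked 0 (n + 2)) (List.replicate n grow)
  | consuming (j m : ℕ) : Config (left :: marked (j + 1) (m + 1))
      (List.replicate (j + m) grow ++ halt :: List.replicate j consume)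

theorem Config.splice {u v w : List Letter} {ls : List Label} {r : FlatRule Letter}
    (hu : Config u ls) (hv : v ∈ countingSystem.I) (hr : r ∈ countingSystem.R)
    (hs : r.Splice u v w) : Config w (ls ++ countingSystem.lab r) := by
  have hr' : r = growRule ∨ r = haltRule ∨ r = consumeRule := by
    simpa [countingSystem] using hr
  rcases hr' with rfl | rfl | rfl
  · obtain ⟨-, x, y, hx, rfl⟩ := (splice_growRule_iff hv).1 hs
    rw [lab_growRule, ← List.replicate_one]
    cases hu with
    | growing n =>
      obtain ⟨rfl, h⟩ := eq_nil_of_left_cons_eq (left_notMem_marked _ _) hx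
      rw [List.replicate_append_replicate]
      convert Config.growing (n + 1) using 1
      rw [List.nil_append, ← h]
      rfl
    | consuming j m =>
      obtain ⟨rfl, h⟩ := eq_nil_of_left_cons_eq (left_notMem_marked _ _) hx
      simp [marked] at h
  · obtain ⟨-, x, y, hx, rfl⟩ := (splice_haltRule_iff hv).1 hs
    rw [lab_haltRule]
    cases hu with
    | growing n =>
      obtain ⟨rfl, h⟩ := eq_nil_of_left_cons_eq (left_notMem_marked _ _) hx
      convert Config.consuming 0 n using 1
      · simp_all [marked, List.replicate_succ]
      · simp
    | consuming j m =>
      obtain ⟨rfl, h⟩ := eq_nil_of_left_cons_eq (left_notMem_marked _ _) hx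
      simp [marked] at h
  · obtain ⟨-, x, y, hx, rfl⟩ := (splice_consumeRule_iff hv).1 hs
    rw [lab_consumeRule, ← List.replicate_one]
    cases x with
    | nil => cases hu <;> simp at hx
    | cons a x =>
      cases hu with
      | growing n =>
        simp only [List.cons_append, List.cons.injEq] at hx
        obtain ⟨-, -, -, hk⟩ := marked_eq_append_mark hx.2
        omega
      | consuming j m =>
        simp only [List.cons_append, List.cons.injEq] at hx
        obtain ⟨rfl, hx⟩ := hx
        obtain ⟨p, rfl, h, -⟩ := marked_eq_append_mark hx
        convert Config.consuming (j + 1) p using 1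
        · simp [h]
        · rw [List.append_assoc, List.cons_append, List.replicate_append_replicate,
            show j + 1 + p = j + (p + 1) by omega]

theorem config_of_deriv {x : List Letter} {ls : List Label} (h : countingSystem.Deriv x ls) :
    Config x ls := by
  induction h with
  | @start x₀ y₀ x₁ r hx hy hr h =>
    have hx' : x₀ = [left, tally, tally] ∨ x₀ = [tally] ∨ x₀ = [mark] := by
      simpa [countingSystem] using hx
    have hlen : 3 ≤ x₀.length := by
      obtain ⟨x, y, z, rfl, -⟩ := h
      have : r = growRule ∨ r = haltRule ∨ r = consumeRule := by
        simpa [countingSystem] using hr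
      rcases this with rfl | rfl | rfl <;> simp [growRule, haltRule, consumeRule] <;> omega
    rcases hx' with rfl | rfl | rfl
    · exact (Config.growing 0).splice hy hr h
    · simp at hlen
    · simp at hlen
  | step _ hy hr h ih => exact ih.splice hy hr h

theorem mem_rules : growRule ∈ countingSystem.R ∧ haltRule ∈ countingSystem.R ∧
    consumeRule ∈ countingSystem.R := by
  simp [countingSystem]

theorem mem_initial : [left, tally, tally] ∈ countingSystem.I ∧ [tally] ∈ countingSystem.I ∧
    [mark] ∈ countingSystem.I := by
  simp [countingSystem]

theorem splice_grow (n : ℕ) :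
    growRule.Splice (left :: marked 0 (n + 2)) [tally] (left :: marked 0 (n + 1 + 2)) :=
  (splice_growRule_iff mem_initial.2.1).2 ⟨rfl, [], List.replicate n tally, rfl, rfl⟩

theorem splice_halt (n : ℕ) :
    haltRule.Splice (left :: marked 0 (n + 2)) [mark] (left :: marked 1 (n + 1)) :=
  (splice_haltRule_iff mem_initial.2.2).2 ⟨rfl, [], List.replicate n tally, rfl, rfl⟩

theorem exists_marked_eq_append (j : ℕ) : ∃ x, ∀ m,
    marked (j + 1) m = x ++ mark :: List.replicate m tally := by
  induction j with
  | zero => exact ⟨[tally], fun m => rfl⟩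
  | succ j ih =>
    obtain ⟨x, hx⟩ := ih
    exact ⟨tally :: mark :: x, fun m => by rw [marked, hx]; rfl⟩

theorem splice_consume (j m : ℕ) :
    consumeRule.Splice (left :: marked (j + 1) (m + 2)) [mark]
      (left :: marked (j + 2) (m + 1)) := by
  obtain ⟨x, hx⟩ := exists_marked_eq_append j
  have hu : marked (j + 1) (m + 2) = x ++ mark :: tally :: tally :: List.replicate m tally := hx _
  obtain ⟨p, hp, h, -⟩ := marked_eq_append_mark hu
  obtain rfl : m = p := by omega
  exact (splice_consumeRule_iff mem_initial.2.2).2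
    ⟨rfl, left :: x, List.replicate m tally, by rw [hu]; rfl, by rw [← h]; rfl⟩

theorem deriv_grow (n : ℕ) :
    countingSystem.Deriv (left :: marked 0 (n + 1 + 2)) (List.replicate (n + 1) grow) := by
  induction n with
  | zero => exact .start mem_initial.1 mem_initial.2.1 mem_rules.1 (splice_grow 0)
  | succ n ih =>
    rw [List.replicate_succ']
    exact ih.step mem_initial.2.1 mem_rules.1 (splice_grow (n + 1))

theorem deriv_consume (j m : ℕ) : countingSystem.Deriv (left :: marked (j + 1) (m + 1))
    (List.replicate (j + m) grow ++ halt :: List.replicate j consume) := by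
  induction j generalizing m with
  | zero =>
    cases m with
    | zero => exact .start mem_initial.1 mem_initial.2.2 mem_rules.2.1 (splice_halt 0)
    | succ m =>
      rw [Nat.zero_add (m + 1)]
      exact (deriv_grow m).step mem_initial.2.2 mem_rules.2.1 (splice_halt (m + 1))
  | succ j ih =>
    rw [List.replicate_succ', ← List.cons_append, ← List.append_assoc,
      show j + 1 + m = j + (m + 1) by omega]
    exact (ih (m + 1)).step mem_initial.2.2 mem_rules.2.2 (splice_consume j m)

theorem not_applicable_marked (j : ℕ) :
    ¬ countingSystem.Applicable (left :: marked (j + 1) 1) := by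
  rintro ⟨r, hr, v, hv, w, h⟩
  have hr' : r = growRule ∨ r = haltRule ∨ r = consumeRule := by
    simpa [countingSystem] using hr
  rcases hr' with rfl | rfl | rfl
  · obtain ⟨-, x, y, hx, -⟩ := (splice_growRule_iff hv).1 h
    obtain ⟨-, h⟩ := eq_nil_of_left_cons_eq (left_notMem_marked _ _) hx
    simp [marked] at h
  · obtain ⟨-, x, y, hx, -⟩ := (splice_haltRule_iff hv).1 h
    obtain ⟨-, h⟩ := eq_nil_of_left_cons_eq (left_notMem_marked _ _) hx
    simp [marked] at h
  · obtain ⟨-, x, y, hx, -⟩ := (splice_consumeRule_iff hv).1 h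
    cases x with
    | nil => simp at hx
    | cons a x =>
      simp only [List.cons_append, List.cons.injEq] at hx
      obtain ⟨p, hp, -⟩ := marked_eq_append_mark (m := 0) hx.2
      omega

theorem mem_derLang_countingSystem {ls : List Label} : ls ∈ countingSystem.derLang ↔
    ∃ n, ls = List.replicate n grow ++ halt :: List.replicate n consume := by
  constructor
  · rintro ⟨x, hx, hterm⟩
    cases config_of_deriv hx with
    | growing n =>
      exact (hterm ⟨_, mem_rules.1, _, mem_initial.2.1, _, splice_grow n⟩).elim
    | consuming j m =>
      cases m with
      | zero => exact ⟨j, rfl⟩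
      | succ m =>
        exact (hterm ⟨_, mem_rules.2.2, _, mem_initial.2.2, _, splice_consume j m⟩).elim
  · rintro ⟨n, rfl⟩
    exact ⟨_, deriv_consume n 0, not_applicable_marked n⟩

theorem not_isRegular_derLang : ¬ countingSystem.derLang.IsRegular := by
  intro h
  have hfin := Language.IsRegular.finite_range_leftQuotient h
  refine Set.infinite_univ (α := ℕ) (Set.Finite.of_injOn
    (f := fun n => countingSystem.derLang.leftQuotient (List.replicate n grow))
    (fun n _ => Set.mem_range_self _) ?_ hfin)
  intro m _ n _ hmn
  have hm : halt :: List.replicate m consume ∈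
      countingSystem.derLang.leftQuotient (List.replicate m grow) :=
    mem_derLang_countingSystem.2 ⟨m, rfl⟩
  simp only at hmn
  rw [hmn] at hm
  obtain ⟨k, hk⟩ := mem_derLang_countingSystem.1 hm
  have hg := congrArg (List.count grow) hk
  have hc := congrArg (List.count consume) hk
  simp [List.count_replicate] at hg hc
  omega

/-- The rule `S → grow S consume`. -/
def wrapRule : ContextFreeRule Label Unit :=
  ⟨(), [.terminal grow, .nonterminal (), .terminal consume]⟩

/-- The rule `S → halt`. -/
def closeRule : ContextFreeRule Label Unit := ⟨(), [.terminal halt]⟩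

/-- The grammar `S → grow S consume | halt`. -/
def countingGrammar : ContextFreeGrammar Label where
  NT := Unit
  initial := ()
  rules := {wrapRule, closeRule}

theorem produces_countingGrammar_iff {u v : List (Symbol Label Unit)} :
    countingGrammar.Produces u v ↔ ∃ p q, u = p ++ .nonterminal () :: q ∧
      (v = p ++ .terminal grow :: .nonterminal () :: .terminal consume :: q ∨
        v = p ++ .terminal halt :: q) := by
  have h : countingGrammar.Produces u v ↔ wrapRule.Rewrites u v ∨ closeRule.Rewrites u v := by
    change (∃ r ∈ ({wrapRule, closeRule} : Finset (ContextFreeRule Label Unit)),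
      r.Rewrites u v) ↔ _
    simp
  rw [h, ContextFreeRule.rewrites_iff, ContextFreeRule.rewrites_iff]
  simp only [wrapRule, closeRule, List.append_assoc, List.cons_append, List.nil_append]
  grind

/-- The sentential form `growⁿ s consumeⁿ`. -/
def sentential (n : ℕ) (s : Symbol Label Unit) : List (Symbol Label Unit) :=
  List.replicate n (.terminal grow) ++ s :: List.replicate n (.terminal consume)

theorem sentential_succ (n : ℕ) (s : Symbol Label Unit) :
    sentential (n + 1) s = List.replicate n (.terminal grow) ++
      .terminal grow :: s :: .terminal consume :: List.replicate n (.terminal consume) := by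
  rw [sentential, List.replicate_succ', List.replicate_succ (a := Symbol.terminal consume),
    List.append_assoc]
  rfl

theorem map_terminal_eq_sentential (n : ℕ) :
    (List.replicate n grow ++ halt :: List.replicate n consume).map Symbol.terminal =
      sentential n (.terminal halt) := by
  simp [sentential]

theorem derives_sentential (n : ℕ) :
    countingGrammar.Derives [.nonterminal ()] (sentential n (.nonterminal ())) := by
  induction n with
  | zero => exact .refl _
  | succ n ih =>
    exact ih.tail (produces_countingGrammar_iff.2 ⟨_, _, rfl, .inl (sentential_succ _ _)⟩)

theorem eq_sentential_of_derives {u : List (Symbol Label Unit)}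
    (h : countingGrammar.Derives [.nonterminal ()] u) :
    ∃ n s, u = sentential n s ∧ (s = .nonterminal () ∨ s = .terminal halt) := by
  induction h with
  | refl => exact ⟨0, _, rfl, .inl rfl⟩
  | tail _ h ih =>
    obtain ⟨n, s, rfl, -⟩ := ih
    obtain ⟨p, q, h, hv⟩ := produces_countingGrammar_iff.1 h
    rw [sentential, List.append_cons_inj_of_notMem (by simp) (by simp)] at h
    obtain ⟨rfl, -, rfl⟩ := h
    rcases hv with rfl | rfl
    · exact ⟨n + 1, _, (sentential_succ _ _).symm, .inl rfl⟩
    · exact ⟨n, _, rfl, .inr rfl⟩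

theorem isContextFree_derLang : countingSystem.derLang.IsContextFree := by
  refine ⟨countingGrammar, ?_⟩
  ext ls
  rw [mem_derLang_countingSystem, ContextFreeGrammar.mem_language_iff]
  constructor
  · intro h
    obtain ⟨n, s, hs, h⟩ := eq_sentential_of_derives h
    change ls.map (Symbol.terminal (N := Unit)) = _ at hs
    rcases h with rfl | rfl
    · have : Symbol.nonterminal () ∈ ls.map (Symbol.terminal (N := Unit)) := by
        rw [hs]; simp [sentential]
      simp at this
    · rw [← map_terminal_eq_sentential] at hs
      exact ⟨n, List.map_injective_iff.2 (fun _ _ => Symbol.terminal.inj) hs⟩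
  · rintro ⟨n, rfl⟩
    refine (derives_sentential n).tail (produces_countingGrammar_iff.2 ⟨_, _, rfl, .inr ?_⟩)
    exact map_terminal_eq_sentential n

theorem countingSystem_szilardLabeled : countingSystem.SzilardLabeled := by
  constructor <;> simp [Set.InjOn, countingSystem, growRule, haltRule, consumeRule]

theorem countingSystem_hasType : countingSystem.HasType 2 1 := by
  simp [LabeledFSS.HasType, countingSystem, growRule, haltRule, consumeRule]

end FlatSplicing

/-- There is a labeled flat splicing system of type `(2, 1)` with finite initial set whose
Szilard language is context-free but not regular. -/
theorem stmt4 :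
    ∃ (A Λ : Type) (_ : Finite A) (_ : Finite Λ) (S : LabeledFSS A Λ),
      S.SzilardLabeled ∧ S.I.Finite ∧ S.HasType 2 1 ∧
      Language.IsContextFree S.derLang ∧ ¬ Language.IsRegular S.derLang := by
  open FlatSplicing in
  exact ⟨Letter, Label, inferInstance, inferInstance, countingSystem,
    countingSystem_szilardLabeled, by simp [countingSystem], countingSystem_hasType,
    isContextFree_derLang, not_isRegular_derLang⟩
end

section
/- For every non-empty regular language L over a terminal alphabet T that does not contain the empty word, there exist a labeled flat splicing system LS of type (1, 2) with finite initial set and a (non-erasing) homomorphism h : Lab* → T* such that L = h(SZ(LS)). -/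
namespace DFA

variable {T σ : Type}

/-- Letters of the splicing system simulating a DFA: `none` is the end marker, and `some (o, q, b)`
records the last letter read `o`, the current state `q`, and whether the simulation stops. -/
abbrev SpliceLetter (T σ : Type) : Type := Option (Option T × σ × Bool)

/-- The rule reading `a` in state `p`; the simulation stops afterwards if `b` is `true`. -/
def spliceRule (M : DFA T σ) (o : Option T) (p : σ) (a : T) (b : Bool) :
    FlatRule (SpliceLetter T σ) where
  lf := [some (o, p, false)]
  rt := [none]
  ins1 := [some (some a, M.step p a, b)]
  ins2 := [some (some a, M.step p a, b)]

/-- The rules simulating `M`: stopping is allowed only in accepting states. -/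
def spliceRules (M : DFA T σ) : Set (FlatRule (SpliceLetter T σ)) :=
  {r | ∃ o p a b, (b = true → M.step p a ∈ M.accept) ∧ r = M.spliceRule o p a b}

theorem finite_spliceRules [Finite T] [Finite σ] (M : DFA T σ) : M.spliceRules.Finite := by
  refine (Set.finite_range fun t : Option T × σ × T × Bool =>
    M.spliceRule t.1 t.2.1 t.2.2.1 t.2.2.2).subset ?_
  rintro r ⟨o, p, a, b, -, rfl⟩
  exact ⟨(o, p, a, b), rfl⟩

/-- The initial words: the start word and the words to be inserted. -/
def spliceInit (M : DFA T σ) : Set (List (SpliceLetter T σ)) :=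
  insert [some (none, M.start, false), none]
    (Set.range fun t : T × σ × Bool => [some (some t.1, t.2), some (some t.1, t.2)])

open Classical in
/-- The labeled flat splicing system simulating `M`, each rule being its own label. -/
noncomputable def spliceSystem [Finite T] [Finite σ] (M : DFA T σ) :
    LabeledFSS (SpliceLetter T σ) M.spliceRules where
  I := M.spliceInit
  R := M.spliceRules
  lab r := if h : r ∈ M.spliceRules then [⟨r, h⟩] else []
  finR := M.finite_spliceRules
  insBound := by
    rintro r ⟨o, p, a, b, -, rfl⟩
    simp [spliceRule]

/-- The word read by a rule; `t` is a default letter. -/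
def ruleWord (M : DFA T σ) (t : T) (r : M.spliceRules) : List T :=
  match r.1.ins1 with
  | [some (some a, _)] => [a]
  | _ => [t]

theorem ruleWord_ne_nil (M : DFA T σ) (t : T) (r : M.spliceRules) : M.ruleWord t r ≠ [] := by
  unfold ruleWord
  split <;> simp

theorem flatMap_lab_spliceRule [Finite T] [Finite σ] (M : DFA T σ) (t : T) {o : Option T} {p : σ}
    {a : T} {b : Bool} (h : M.spliceRule o p a b ∈ M.spliceRules) :
    (M.spliceSystem.lab (M.spliceRule o p a b)).flatMap (M.ruleWord t) = [a] := by
  have hl : M.spliceSystem.lab (M.spliceRule o p a b) = [⟨_, h⟩] := dif_pos h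
  rw [hl]
  simp [ruleWord, spliceRule]

theorem append_marker_inj {α : Type} {xs x y : List (Option α)} {c l : α} (hxs : none ∉ xs)
    (h : xs ++ [some c, none] = x ++ [some l] ++ [none] ++ y) : x = xs ∧ l = c ∧ y = [] := by
  induction xs generalizing x with
  | nil =>
    rcases x with _ | ⟨a, _ | ⟨b, x⟩⟩
    · simp only [List.nil_append, List.cons_append, List.cons.injEq, Option.some.injEq] at h
      exact ⟨rfl, h.1.symm, h.2.2.symm⟩
    · simp at h
    · simp at h
  | cons d xs ih =>
    rcases x with _ | ⟨a, x⟩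
    · rcases xs with _ | ⟨e, xs⟩
      · simp at h
      · simp only [List.cons_append, List.nil_append, List.cons.injEq] at h
        simp [h.2.1] at hxs
    · simp only [List.cons_append, List.cons.injEq] at h
      obtain ⟨rfl, rfl, rfl⟩ := ih (fun hm => hxs (.tail _ hm)) h.2
      simp [h.1]

theorem spliceRule_splice_iff (M : DFA T σ) {xs v w : List (SpliceLetter T σ)}
    {c : Option T × σ × Bool} {o : Option T} {p : σ} {a : T} {b : Bool} (hxs : none ∉ xs)
    (hv : v ∈ M.spliceInit) :
    (M.spliceRule o p a b).Splice (xs ++ [some c, none]) v w ↔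
      c = (o, p, false) ∧
      v = [some (some a, M.step p a, b), some (some a, M.step p a, b)] ∧
      w = (xs ++ [some c, some (some a, M.step p a, b)]) ++
        [some (some a, M.step p a, b), none] := by
  constructor
  · rintro ⟨x, y, z, hu, hz, -, rfl⟩
    obtain ⟨rfl, rfl, rfl⟩ := append_marker_inj hxs hu
    have hv' : v = [some (some a, M.step p a, b), some (some a, M.step p a, b)] := by
      rcases hv with rfl | ⟨t, rfl⟩
      · simp [spliceRule] at hz
      · simp only [spliceRule, List.cons_append, List.nil_append, List.cons.injEq] at hz
        simp [hz.1]
    subst hv'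
    simp [spliceRule]
  · rintro ⟨rfl, rfl, rfl⟩
    exact ⟨xs, [], [], by simp [spliceRule]⟩

theorem insert_mem_spliceInit (M : DFA T σ) (a : T) (q : σ) (b : Bool) :
    [some (some a, q, b), some (some a, q, b)] ∈ M.spliceInit :=
  Or.inr ⟨(a, q, b), rfl⟩

/-- A word with end marker is terminal exactly when its last letter says that the simulation has
stopped. -/
theorem not_applicable_iff [Finite T] [Finite σ] [Nonempty T] (M : DFA T σ)
    {xs : List (SpliceLetter T σ)} {o : Option T} {q : σ} {b : Bool} (hxs : none ∉ xs) :
    ¬ M.spliceSystem.Applicable (xs ++ [some (o, q, b), none]) ↔ b = true := by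
  constructor
  · intro h
    by_contra hb
    obtain ⟨a⟩ := ‹Nonempty T›
    refine h ⟨M.spliceRule o q a false, ⟨o, q, a, false, by simp, rfl⟩, _,
      M.insert_mem_spliceInit a (M.step q a) false, _,
      (M.spliceRule_splice_iff hxs (M.insert_mem_spliceInit _ _ _)).2 ⟨?_, rfl, rfl⟩⟩
    simpa using hb
  · rintro rfl ⟨r, ⟨o', p, a, b, -, rfl⟩, v, hv, w, h⟩
    simpa using ((M.spliceRule_splice_iff hxs hv).1 h).1

/-- The derivation invariant: the last state letter is the state reached on the word read. -/
theorem deriv_invariant [Finite T] [Finite σ] (M : DFA T σ) (t : T)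
    {x : List (SpliceLetter T σ)} {ls : List M.spliceRules} (h : M.spliceSystem.Deriv x ls) :
    ∃ xs o b, none ∉ xs ∧ x = xs ++ [some (o, M.eval (ls.flatMap (M.ruleWord t)), b), none] ∧
      (b = true → M.eval (ls.flatMap (M.ruleWord t)) ∈ M.accept) := by
  induction h with
  | @start x₀ y₀ x₁ r hx hy hr hs =>
    obtain ⟨o, p, a, b, hb, rfl⟩ := id hr
    rw [M.flatMap_lab_spliceRule t hr]
    rcases hx with rfl | ⟨u, rfl⟩
    · obtain ⟨hc, -, rfl⟩ := (M.spliceRule_splice_iff (xs := []) (by simp) hy).1 hs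
      simp only [Prod.mk.injEq] at hc
      obtain ⟨rfl, rfl, -⟩ := hc
      exact ⟨_, _, b, by simp, rfl, hb⟩
    · obtain ⟨x, y, z, hu, -⟩ := hs
      have := congrArg (none ∈ ·) hu
      simp [spliceRule] at this
  | @step x y w ls r _ hy hr hs ih =>
    obtain ⟨xs, o', b', hxs, rfl, -⟩ := ih
    obtain ⟨o, p, a, b, hb, rfl⟩ := id hr
    rw [List.flatMap_append, M.flatMap_lab_spliceRule t hr, M.eval_append_singleton]
    obtain ⟨hc, -, rfl⟩ := (M.spliceRule_splice_iff hxs hy).1 hs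
    simp only [Prod.mk.injEq] at hc
    obtain ⟨rfl, rfl, -⟩ := hc
    exact ⟨_, _, b, by simp [hxs], rfl, hb⟩

theorem exists_deriv [Finite T] [Finite σ] (M : DFA T σ) (t : T) {w : List T} (hw : w ≠ [])
    (b : Bool) (hb : b = true → M.eval w ∈ M.accept) :
    ∃ xs o ls, none ∉ xs ∧ M.spliceSystem.Deriv (xs ++ [some (o, M.eval w, b), none]) ls ∧
      ls.flatMap (M.ruleWord t) = w := by
  induction w using List.reverseRecOn generalizing b with
  | nil => exact absurd rfl hw
  | append_singleton w a ih =>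
    rw [M.eval_append_singleton] at hb ⊢
    have hr (o) : M.spliceRule o (M.eval w) a b ∈ M.spliceRules := ⟨o, _, a, b, hb, rfl⟩
    have hy := M.insert_mem_spliceInit a (M.step (M.eval w) a) b
    by_cases hn : w = []
    · subst hn
      refine ⟨_, _, _, ?_, .start (Or.inl rfl) hy (hr none)
        ((M.spliceRule_splice_iff (xs := []) (by simp) hy).2 ⟨rfl, rfl, rfl⟩),
        M.flatMap_lab_spliceRule t (hr _)⟩
      simp
    · obtain ⟨xs, o, ls, hxs, hd, hls⟩ := ih hn false (by simp)
      refine ⟨_, _, _, ?_, .step hd hy (hr o)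
        ((M.spliceRule_splice_iff hxs hy).2 ⟨rfl, rfl, rfl⟩), ?_⟩
      · simp [hxs]
      · rw [List.flatMap_append, M.flatMap_lab_spliceRule t (hr _), hls]

theorem szilardLabeled_spliceSystem [Finite T] [Finite σ] (M : DFA T σ) :
    M.spliceSystem.SzilardLabeled := by
  constructor
  · intro r (hr : r ∈ M.spliceRules)
    simp [spliceSystem, hr]
  · intro r (hr : r ∈ M.spliceRules) s (hs : s ∈ M.spliceRules) h
    simpa [spliceSystem, hr, hs] using h

theorem hasType_spliceSystem [Finite T] [Finite σ] [Nonempty T] (M : DFA T σ) :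
    M.spliceSystem.HasType 1 2 := by
  obtain ⟨a⟩ := ‹Nonempty T›
  have h0 : M.spliceRule none M.start a false ∈ M.spliceSystem.R :=
    ⟨none, M.start, a, false, by simp, rfl⟩
  refine ⟨?_, ⟨_, h0, Or.inl rfl⟩, ?_, ⟨_, h0, rfl⟩⟩ <;>
  · rintro r ⟨o, p, a, b, -, rfl⟩
    simp [spliceRule]

end DFA

/-- Every non-empty `λ`-free regular language is the image, under a non-erasing
homomorphism, of the Szilard language of some labeled flat splicing system of type `(1, 2)`
with finite initial set. -/
theorem stmt13 (T : Type) [Finite T] (L : Language T)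
    (hreg : Language.IsRegular L) (hne : ∃ w, w ∈ L) (hfree : [] ∉ L) :
    ∃ (A Λ : Type) (_ : Finite A) (_ : Finite Λ) (S : LabeledFSS A Λ) (f : Λ → List T),
      S.SzilardLabeled ∧ S.I.Finite ∧ S.HasType 1 2 ∧
      (∀ l : Λ, f l ≠ []) ∧
      L = { w | ∃ u ∈ S.derLang, w = u.flatMap f } := by
  obtain ⟨σ, _, M, rfl⟩ := hreg
  obtain ⟨w₀, hw₀⟩ := hne
  obtain ⟨t, -⟩ := List.exists_mem_of_ne_nil w₀ fun h => hfree (h ▸ hw₀)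
  have : Nonempty T := ⟨t⟩
  have : Finite M.spliceRules := M.finite_spliceRules
  refine ⟨DFA.SpliceLetter T σ, M.spliceRules, inferInstance, this, M.spliceSystem,
    M.ruleWord t, M.szilardLabeled_spliceSystem, (Set.finite_range _).insert _,
    M.hasType_spliceSystem, M.ruleWord_ne_nil t, Set.ext fun w => ⟨fun hw => ?_, ?_⟩⟩
  · obtain ⟨xs, o, ls, hxs, hd, hls⟩ :=
      M.exists_deriv t (fun h => hfree (h ▸ hw)) true fun _ => hw
    exact ⟨ls, ⟨_, hd, (M.not_applicable_iff hxs).2 rfl⟩, hls.symm⟩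
  · rintro ⟨ls, ⟨x, hd, hx⟩, rfl⟩
    obtain ⟨xs, o, b, hxs, rfl, hb⟩ := M.deriv_invariant t hd
    exact hb ((M.not_applicable_iff hxs).1 hx)
end

section
/- For every non-empty context-free language L over a terminal alphabet T that does not contain the empty word, there exist a labeled flat splicing system LS of type (2, 2) with finite initial set and a homomorphism h : Lab* → T* such that L = h(SZ(LS)). -/
/-- A rewriting system with productions `p : lhs p → rhs p`, each of which emits the word `out p`. -/
structure EmittingSystem (T Q P : Type) where
  /-- the rewritten symbol -/
  lhs : P → Q
  /-- the emitted word -/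
  out : P → List T
  /-- the replacement -/
  rhs : P → List Q

namespace EmittingSystem

variable {T Q P : Type} (E : EmittingSystem T Q P)

/-- `E.Gen s w`: leftmost rewriting can erase `s`, emitting `w` in total. -/
inductive Gen : List Q → List T → Prop
  | nil : Gen [] []
  | cons (p : P) {s : List Q} {w : List T} :
      Gen (E.rhs p ++ s) w → Gen (E.lhs p :: s) (E.out p ++ w)

variable {E}

lemma Gen.append {s t : List Q} {v w : List T} (hs : E.Gen s v) (ht : E.Gen t w) :
    E.Gen (s ++ t) (v ++ w) := by
  induction hs with
  | nil => exact ht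
  | cons p _ ih =>
    rw [List.append_assoc]
    exact Gen.cons p (by simpa using ih)

lemma Gen.split {s t : List Q} {w : List T} (h : E.Gen (s ++ t) w) :
    ∃ u v, w = u ++ v ∧ E.Gen s u ∧ E.Gen t v := by
  generalize hx : s ++ t = x at h
  induction h generalizing s with
  | nil =>
    obtain ⟨rfl, rfl⟩ := List.append_eq_nil_iff.1 hx
    exact ⟨[], [], rfl, .nil, .nil⟩
  | @cons p x w h ih =>
    rcases s with _ | ⟨q, s⟩
    · obtain rfl : t = _ := hx
      exact ⟨[], _, rfl, .nil, .cons p h⟩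
    · obtain ⟨rfl, rfl⟩ := List.cons_eq_cons.1 hx
      obtain ⟨u, v, rfl, hu, hv⟩ := ih (s := E.rhs p ++ s) (by simp)
      exact ⟨E.out p ++ u, v, by simp, .cons p hu, hv⟩

/-- Letters of the splicing system simulating an `EmittingSystem`. -/
inductive Letter (Q P : Type)
  | stack (q : Option Q)
  | prod (p : P)
  | mark

instance [Finite Q] [Finite P] : Finite (Letter Q P) :=
  Finite.of_injective (β := Option (Option Q ⊕ P))
    (fun
      | .stack q => some (.inl q)
      | .prod p => some (.inr p)
      | .mark => none)
    (by rintro (_ | _ | _) (_ | _ | _) <;> simp)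

open Letter

variable (E)

/-- The rule inserting the right-hand side of `p` below the top of the stack. -/
def expandRule (p : P) (z : Option Q) : FlatRule (Letter Q P) :=
  ⟨[mark, stack (some (E.lhs p))], [stack z], [prod p], []⟩

/-- The rule marking the new top of the stack after `p` has been inserted. -/
def markRule (p : P) (z : Option Q) : FlatRule (Letter Q P) :=
  ⟨[stack (some (E.lhs p)), prod p], [stack z], [mark], [mark]⟩

/-- A stack with its bottom symbol, as a word. -/
def stackWord (s : List Q) : List (Letter Q P) :=
  s.map (fun q => stack (some q)) ++ [stack none]

/-- The word inserted for the production `p`. -/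
def prodWord (p : P) : List (Letter Q P) :=
  prod p :: (E.rhs p).map (fun q => stack (some q))

/-- The word with consumed productions `h` and remaining word `t` to the right of the marker. -/
def word : List P → List (Letter Q P) → List (Letter Q P)
  | [], t => mark :: t
  | p :: h, t => mark :: stack (some (E.lhs p)) :: prod p :: mark :: word h t

lemma word_append (h : List P) (t u : List (Letter Q P)) :
    E.word h t ++ u = E.word h (t ++ u) := by
  induction h with
  | nil => rfl
  | cons p h ih => simp [word, ih]

lemma word_concat (h : List P) (p : P) (t : List (Letter Q P)) :
    E.word (h ++ [p]) t
      = E.word h (stack (some (E.lhs p)) :: prod p :: mark :: mark :: t) := by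
  induction h with
  | nil => rfl
  | cons p h ih => simp [word, ih]

lemma exists_word_eq_concat (h : List P) : ∃ x, E.word h [] = x ++ [mark] := by
  induction h with
  | nil => exact ⟨[], rfl⟩
  | cons p h ih =>
    obtain ⟨x, hx⟩ := ih
    exact ⟨mark :: stack (some (E.lhs p)) :: prod p :: mark :: x, by simp [word, hx]⟩

/-- The words that the rules insert, together with the start word. -/
def initials (q : Q) : Set (List (Letter Q P)) :=
  {E.word [] (stackWord [q]), [mark, mark]} ∪ Set.range E.prodWord

/-- The splicing rules. -/
def rules : Set (FlatRule (Letter Q P)) :=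
  Set.range (fun x : P × Option Q => E.expandRule x.1 x.2) ∪
    Set.range (fun x : P × Option Q => E.markRule x.1 x.2)

/-- The word emitted by a splicing rule. -/
def ruleOut (r : FlatRule (Letter Q P)) : List T :=
  match r.ins1 with
  | [prod p] => E.out p
  | _ => []

open Classical in
/-- The flat splicing system simulating `E` from the stack `[q]`, each rule labeled by itself. -/
noncomputable def splicing [Finite Q] [Finite P] (q : Q) :
    LabeledFSS (Letter Q P) E.rules where
  I := E.initials q
  R := E.rules
  lab r := if h : r ∈ E.rules then [⟨r, h⟩] else []
  finR := (Set.finite_range _).union (Set.finite_range _)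
  insBound := by
    rintro r (⟨x, rfl⟩ | ⟨x, rfl⟩) <;> simp [expandRule, markRule]

variable {E}

/-- The three-letter windows in which a rule can be applied. -/
def Window (l₁ l₂ l₃ : Letter Q P) : Prop :=
  (∃ o z, l₁ = mark ∧ l₂ = stack (some o) ∧ l₃ = stack z) ∨
    ∃ o p z, l₁ = stack o ∧ l₂ = prod p ∧ l₃ = stack z

lemma not_window_stack_stack (o o' : Option Q) (l : Letter Q P) :
    ¬ Window (stack o) (stack o') l := by
  simp [Window]

lemma eq_stack_of_mem_stackWord {s : List Q} {l : Letter Q P} (h : l ∈ stackWord s) :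
    ∃ o, l = stack o := by
  simp only [stackWord, List.mem_append, List.mem_map, List.mem_singleton] at h
  rcases h with ⟨q, -, rfl⟩ | rfl <;> exact ⟨_, rfl⟩

lemma not_window_of_stackWord {s : List Q} {a b : List (Letter Q P)} {l₁ l₂ l₃ : Letter Q P}
    (he : stackWord s = a ++ l₁ :: l₂ :: l₃ :: b) : ¬ Window l₁ l₂ l₃ := by
  obtain ⟨o, rfl⟩ := eq_stack_of_mem_stackWord (l := l₁) (s := s) (by simp [he])
  obtain ⟨o', rfl⟩ := eq_stack_of_mem_stackWord (l := l₂) (s := s) (by simp [he])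
  exact not_window_stack_stack _ _ _

lemma window_cons_cons {p : P} {h : List P} {t a b : List (Letter Q P)}
    {l₁ l₂ l₃ : Letter Q P} (hw : Window l₁ l₂ l₃)
    (he : E.word (p :: h) t = a ++ l₁ :: l₂ :: l₃ :: b) :
    ∃ a', a = mark :: stack (some (E.lhs p)) :: prod p :: mark :: a' ∧
      E.word h t = a' ++ l₁ :: l₂ :: l₃ :: b := by
  rcases a with _ | ⟨_, _ | ⟨_, _ | ⟨_, _ | ⟨_, a⟩⟩⟩⟩
  · simp only [word, List.nil_append, List.cons.injEq] at he
    obtain ⟨rfl, rfl, rfl, -⟩ := he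
    simp [Window] at hw
  · simp only [word, List.cons_append, List.nil_append, List.cons.injEq] at he
    obtain ⟨-, rfl, rfl, rfl, -⟩ := he
    simp [Window] at hw
  · simp only [word, List.cons_append, List.nil_append, List.cons.injEq] at he
    obtain ⟨-, -, rfl, rfl, -⟩ := he
    simp [Window] at hw
  · obtain ⟨u, hu⟩ : ∃ u, E.word h t = mark :: u := by cases h <;> exact ⟨_, rfl⟩
    simp only [word, hu, List.cons_append, List.nil_append, List.cons.injEq] at he
    obtain ⟨-, -, -, rfl, rfl, -⟩ := he
    simp [Window] at hw
  · simp only [word, List.cons_append, List.cons.injEq] at he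
    obtain ⟨rfl, rfl, rfl, rfl, he⟩ := he
    exact ⟨a, rfl, he⟩

lemma window_stackWord {h : List P} {s : List Q} {a b : List (Letter Q P)}
    {l₁ l₂ l₃ : Letter Q P} (hw : Window l₁ l₂ l₃)
    (he : E.word h (stackWord s) = a ++ l₁ :: l₂ :: l₃ :: b) :
    ∃ o s', s = o :: s' ∧ a ++ [l₁] = E.word h [] ∧ l₁ = mark ∧ l₂ = stack (some o) ∧
      l₃ :: b = stackWord s' := by
  induction h generalizing a with
  | nil =>
    rcases a with _ | ⟨l, a⟩
    · simp only [word, List.nil_append, List.cons.injEq] at he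
      obtain ⟨rfl, he⟩ := he
      rcases s with _ | ⟨o, s⟩
      · simp [stackWord] at he
      · simp only [stackWord, List.map_cons, List.cons_append, List.cons.injEq] at he
        exact ⟨o, s, rfl, rfl, rfl, he.1.symm, he.2.symm⟩
    · simp only [word, List.cons_append, List.cons.injEq] at he
      exact (not_window_of_stackWord he.2 hw).elim
  | cons p h ih =>
    obtain ⟨a', rfl, he'⟩ := window_cons_cons hw he
    obtain ⟨o, s', rfl, ha, h'⟩ := ih he'
    exact ⟨o, s', rfl, by simp [word, ← ha], h'⟩

lemma window_prod {h : List P} {s : List Q} {q : Q} {p : P} {a b : List (Letter Q P)}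
    {l₁ l₂ l₃ : Letter Q P} (hw : Window l₁ l₂ l₃)
    (he : E.word h (stack (some q) :: prod p :: stackWord s) = a ++ l₁ :: l₂ :: l₃ :: b) :
    a = E.word h [] ∧ l₁ = stack (some q) ∧ l₂ = prod p ∧ l₃ :: b = stackWord s := by
  induction h generalizing a with
  | nil =>
    rcases a with _ | ⟨_, _ | ⟨_, _ | ⟨_, a⟩⟩⟩
    · simp only [word, List.nil_append, List.cons.injEq] at he
      obtain ⟨rfl, rfl, rfl, -⟩ := he
      simp [Window] at hw
    · simp only [word, List.cons_append, List.nil_append, List.cons.injEq] at he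
      obtain ⟨rfl, rfl, rfl, he⟩ := he
      exact ⟨rfl, rfl, rfl, he.symm⟩
    · simp only [word, List.cons_append, List.nil_append, List.cons.injEq] at he
      obtain ⟨-, -, rfl, he⟩ := he
      obtain ⟨o, rfl⟩ := eq_stack_of_mem_stackWord (l := l₂) (s := s) (by simp [he])
      simp [Window] at hw
    · simp only [word, List.cons_append, List.cons.injEq] at he
      exact (not_window_of_stackWord he.2.2.2 hw).elim
  | cons p' h ih =>
    obtain ⟨a', rfl, he'⟩ := window_cons_cons hw he
    obtain ⟨ha, h'⟩ := ih he'
    exact ⟨by simp [word, ← ha], h'⟩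

lemma eq_prodWord_of_mem_initials {q : Q} {p : P} {z : List (Letter Q P)}
    (h : prod p :: z ∈ E.initials q) : prod p :: z = E.prodWord p := by
  rcases h with (h | h) | ⟨p', h⟩
  · simp [word] at h
  · simp at h
  · obtain rfl : p' = p := by simpa [prodWord] using (List.cons.inj h).1
    exact h.symm

lemma eq_nil_of_mem_initials {q : Q} {z : List (Letter Q P)}
    (h : mark :: (z ++ [mark]) ∈ E.initials q) : z = [] := by
  rcases h with (h | h) | ⟨p', h⟩
  · have := congrArg List.getLast? h
    rw [← List.cons_append, List.getLast?_concat] at this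
    simp [word, stackWord] at this
  · simpa using h
  · simp [prodWord] at h

lemma splice_stackWord {q : Q} {h : List P} {s : List Q} {v w : List (Letter Q P)}
    {r : FlatRule (Letter Q P)} (hr : r ∈ E.rules) (hv : v ∈ E.initials q)
    (hs : r.Splice (E.word h (stackWord s)) v w) :
    ∃ p s', s = E.lhs p :: s' ∧ E.ruleOut r = E.out p ∧
      w = E.word h (stack (some (E.lhs p)) :: prod p :: stackWord (E.rhs p ++ s')) := by
  obtain ⟨x, y, z, hu, rfl, -, rfl⟩ := hs
  rcases hr with ⟨⟨p, o⟩, rfl⟩ | ⟨⟨p, o⟩, rfl⟩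
  · simp only [expandRule, List.append_assoc, List.cons_append, List.nil_append] at hu
    obtain ⟨c, s', rfl, hx, -, hc, hy⟩ := window_stackWord (.inl ⟨_, _, rfl, rfl, rfl⟩) hu
    obtain rfl : E.lhs p = c := by simpa using hc
    have hz : prod p :: z = E.prodWord p :=
      eq_prodWord_of_mem_initials (by simpa [expandRule] using hv)
    obtain rfl := (List.cons.inj hz).2
    refine ⟨p, s', rfl, rfl, ?_⟩
    have := E.word_append h [] (stack (some (E.lhs p)) :: prod p :: stackWord (E.rhs p ++ s'))
    rw [List.nil_append] at this
    rw [← this, ← hx]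
    have hy' := hy.symm
    simp only [stackWord] at hy'
    simp [expandRule, stackWord, hy']
  · simp only [markRule, List.append_assoc, List.cons_append, List.nil_append] at hu
    obtain ⟨c, s', rfl, hx, hm, -⟩ := window_stackWord (.inr ⟨_, _, _, rfl, rfl, rfl⟩) hu
    simp at hm

lemma splice_prod {q : Q} {p : P} {h : List P} {s : List Q} {v w : List (Letter Q P)}
    {r : FlatRule (Letter Q P)} (hr : r ∈ E.rules) (hv : v ∈ E.initials q)
    (hs : r.Splice (E.word h (stack (some (E.lhs p)) :: prod p :: stackWord s)) v w) :
    E.ruleOut r = [] ∧ w = E.word (h ++ [p]) (stackWord s) := by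
  obtain ⟨x, y, z, hu, rfl, -, rfl⟩ := hs
  rcases hr with ⟨⟨p', o⟩, rfl⟩ | ⟨⟨p', o⟩, rfl⟩
  · simp only [expandRule, List.append_assoc, List.cons_append, List.nil_append] at hu
    obtain ⟨-, hm, -⟩ := window_prod (.inl ⟨_, _, rfl, rfl, rfl⟩) hu
    simp at hm
  · simp only [markRule, List.append_assoc, List.cons_append, List.nil_append] at hu
    obtain ⟨rfl, -, hp, hy⟩ := window_prod (.inr ⟨_, _, _, rfl, rfl, rfl⟩) hu
    obtain rfl : p' = p := by simpa using hp
    obtain rfl : z = [] := eq_nil_of_mem_initials (by simpa [markRule] using hv)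
    refine ⟨rfl, ?_⟩
    rw [word_concat, ← hy]
    simp [markRule, word_append]

lemma exists_stackWord_eq_cons (s : List Q) :
    ∃ z b, (stackWord s : List (Letter Q P)) = stack z :: b := by
  cases s <;> exact ⟨_, _, rfl⟩

lemma exists_splice_stackWord (h : List P) (p : P) (s : List Q) :
    ∃ r ∈ E.rules, E.ruleOut r = E.out p ∧
      r.Splice (E.word h (stackWord (E.lhs p :: s))) (E.prodWord p)
        (E.word h (stack (some (E.lhs p)) :: prod p :: stackWord (E.rhs p ++ s))) := by
  obtain ⟨z, b, hb⟩ := exists_stackWord_eq_cons (P := P) s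
  have hb' := hb
  simp only [stackWord] at hb'
  refine ⟨E.expandRule p z, .inl ⟨(p, z), rfl⟩, rfl, ?_⟩
  obtain ⟨x, hx⟩ := E.exists_word_eq_concat h
  have hw (t : List (Letter Q P)) : E.word h t = x ++ mark :: t := by
    have := E.word_append h [] t
    rw [hx] at this
    simpa using this.symm
  refine ⟨x, b, (E.rhs p).map fun q => stack (some q), ?_, ?_, ?_, ?_⟩ <;>
    simp [hw, expandRule, prodWord, stackWord, hb']

lemma exists_splice_prod (h : List P) (p : P) (s : List Q) :
    ∃ r ∈ E.rules, E.ruleOut r = [] ∧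
      r.Splice (E.word h (stack (some (E.lhs p)) :: prod p :: stackWord s)) [mark, mark]
        (E.word (h ++ [p]) (stackWord s)) := by
  obtain ⟨z, b, hb⟩ := exists_stackWord_eq_cons (P := P) s
  refine ⟨E.markRule p z, .inr ⟨(p, z), rfl⟩, rfl, E.word h [], b, [], ?_, ?_, ?_, ?_⟩ <;>
    simp [markRule, word_append, word_concat, hb]

/-- The invariant: `x` encodes a stack reached from `[q]` while emitting `w`. -/
def Encodes (q : Q) (x : List (Letter Q P)) (w : List T) : Prop :=
  ∃ h s, (x = E.word h (stackWord s) ∨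
      ∃ p, x = E.word h (stack (some (E.lhs p)) :: prod p :: stackWord s)) ∧
    ∀ w', E.Gen s w' → E.Gen [q] (w ++ w')

lemma Encodes.splice {q : Q} {x v y : List (Letter Q P)} {w : List T}
    {r : FlatRule (Letter Q P)} (hx : E.Encodes q x w) (hr : r ∈ E.rules)
    (hv : v ∈ E.initials q) (hs : r.Splice x v y) : E.Encodes q y (w ++ E.ruleOut r) := by
  obtain ⟨h, s, rfl | ⟨p, rfl⟩, hg⟩ := hx
  · obtain ⟨p, s', rfl, ho, rfl⟩ := splice_stackWord hr hv hs
    refine ⟨h, _, .inr ⟨p, rfl⟩, fun w' hw' => ?_⟩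
    rw [ho, List.append_assoc]
    exact hg _ (.cons p hw')
  · obtain ⟨ho, rfl⟩ := splice_prod hr hv hs
    exact ⟨_, s, .inl rfl, by simpa [ho] using hg⟩

lemma exists_window_of_splice {x v y : List (Letter Q P)} {r : FlatRule (Letter Q P)}
    (hr : r ∈ E.rules) (hs : r.Splice x v y) :
    ∃ a b l₁ l₂ l₃, Window l₁ l₂ l₃ ∧ x = a ++ l₁ :: l₂ :: l₃ :: b := by
  obtain ⟨a, b, z, rfl, -⟩ := hs
  rcases hr with ⟨⟨p, o⟩, rfl⟩ | ⟨⟨p, o⟩, rfl⟩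
  · exact ⟨a, b, _, _, _, .inl ⟨E.lhs p, o, rfl, rfl, rfl⟩, by simp [expandRule]⟩
  · exact ⟨a, b, _, _, _, .inr ⟨some (E.lhs p), p, o, rfl, rfl, rfl⟩, by simp [markRule]⟩

lemma initials_splice {q : Q} {x v y : List (Letter Q P)}
    {r : FlatRule (Letter Q P)} (hx : x ∈ E.initials q) (hr : r ∈ E.rules)
    (hv : v ∈ E.initials q) (hs : r.Splice x v y) : E.Encodes q y (E.ruleOut r) := by
  rcases hx with (rfl | rfl) | ⟨p, rfl⟩
  · have : E.Encodes q (E.word [] (stackWord [q])) [] := ⟨[], [q], .inl rfl, fun _ h => h⟩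
    exact this.splice hr hv hs
  · obtain ⟨a, b, l₁, l₂, l₃, -, he⟩ := exists_window_of_splice hr hs
    have := congrArg List.length he
    simp only [List.length_cons, List.length_nil, List.length_append] at this
    omega
  · obtain ⟨a, b, l₁, l₂, l₃, hw, he⟩ := exists_window_of_splice hr hs
    rcases a with _ | ⟨l, a⟩
    · obtain ⟨rfl, -⟩ := List.cons.inj he
      simp [Window] at hw
    · have he' := (List.cons.inj he).2
      refine (not_window_of_stackWord (s := E.rhs p) (a := a) (b := b ++ [stack none]) ?_ hw).elim
      rw [stackWord, he']
      simp

section Splicing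

variable [Finite Q] [Finite P] {q : Q}

lemma lab_of_mem {r : FlatRule (Letter Q P)} (hr : r ∈ E.rules) :
    (E.splicing q).lab r = [⟨r, hr⟩] := dif_pos hr

lemma encodes_of_deriv {x : List (Letter Q P)} {ls : List E.rules}
    (h : (E.splicing q).Deriv x ls) :
    E.Encodes q x (ls.flatMap fun r : E.rules => E.ruleOut r.1) := by
  induction h with
  | start hx hy hr hs =>
    rw [lab_of_mem hr]
    simpa using initials_splice hx hr hy hs
  | step _ hy hr hs ih =>
    rw [lab_of_mem hr]
    simpa using ih.splice hr hy hs

lemma gen_of_mem_derLang (hE : ∀ q, ∃ p, E.lhs p = q) {ls : List E.rules}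
    (h : ls ∈ (E.splicing q).derLang) :
    E.Gen [q] (ls.flatMap fun r : E.rules => E.ruleOut r.1) := by
  obtain ⟨x, hx, hn⟩ := h
  obtain ⟨h, s, rfl | ⟨p, rfl⟩, hg⟩ := encodes_of_deriv hx
  · rcases s with _ | ⟨o, s⟩
    · simpa using hg [] .nil
    · obtain ⟨p, rfl⟩ := hE o
      obtain ⟨r, hr, -, hs⟩ := exists_splice_stackWord h p s
      exact (hn ⟨r, hr, _, .inr ⟨p, rfl⟩, _, hs⟩).elim
  · obtain ⟨r, hr, -, hs⟩ := exists_splice_prod h p s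
    exact (hn ⟨r, hr, _, .inl (.inr rfl), _, hs⟩).elim

variable (E q) in
/-- `x` is the start word, or derivable while emitting `w`. -/
def Reach (x : List (Letter Q P)) (w : List T) : Prop :=
  (x = E.word [] (stackWord [q]) ∧ w = []) ∨
    ∃ ls, (E.splicing q).Deriv x ls ∧ w = ls.flatMap fun r : E.rules => E.ruleOut r.1

lemma Reach.splice {x v y : List (Letter Q P)} {w : List T} {r : FlatRule (Letter Q P)}
    (hx : E.Reach q x w) (hr : r ∈ E.rules) (hv : v ∈ E.initials q) (hs : r.Splice x v y) :
    E.Reach q y (w ++ E.ruleOut r) := by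
  rcases hx with ⟨rfl, rfl⟩ | ⟨ls, hd, rfl⟩
  · exact .inr ⟨_, .start (S := E.splicing q) (.inl (.inl rfl)) hv hr hs, by simp [lab_of_mem hr]⟩
  · exact .inr ⟨_, .step hd hv hr hs, by simp [lab_of_mem hr]⟩

lemma Gen.reach {s : List Q} {w : List T} (hg : E.Gen s w) (h : List P) (w₀ : List T)
    (hx : E.Reach q (E.word h (stackWord s)) w₀) :
    ∃ h', E.Reach q (E.word h' (stackWord [])) (w₀ ++ w) := by
  induction hg generalizing h w₀ with
  | nil => exact ⟨h, by simpa using hx⟩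
  | @cons p s w _ ih =>
    obtain ⟨r, hr, ho, hs⟩ := exists_splice_stackWord (E := E) h p s
    obtain ⟨r', hr', ho', hs'⟩ := exists_splice_prod (E := E) h p (E.rhs p ++ s)
    obtain ⟨h', hh⟩ := ih _ _ ((hx.splice hr (.inr ⟨p, rfl⟩) hs).splice hr' (.inl (.inr rfl)) hs')
    exact ⟨h', by simpa [ho, ho'] using hh⟩

lemma Gen.exists_mem_derLang {w : List T} (hg : E.Gen [q] w) :
    ∃ ls ∈ (E.splicing q).derLang, w = ls.flatMap fun r : E.rules => E.ruleOut r.1 := by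
  obtain ⟨h, hx | ⟨ls, hd, hw⟩⟩ := hg.reach (q := q) [] [] (.inl ⟨rfl, rfl⟩)
  · rcases h with _ | ⟨p, h⟩ <;> simp [word, stackWord] at hx
  · refine ⟨ls, ⟨_, hd, ?_⟩, by simpa using hw⟩
    rintro ⟨r, hr, v, hv, y, hs⟩
    obtain ⟨p, s', hs', -⟩ := splice_stackWord hr hv hs
    simp at hs'

lemma splicing_szilardLabeled : (E.splicing q).SzilardLabeled := by
  refine ⟨fun r hr => by rw [lab_of_mem hr]; rfl, fun r hr r' hr' he => ?_⟩
  rw [lab_of_mem hr, lab_of_mem hr'] at he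
  exact congrArg Subtype.val (List.singleton_inj.1 he)

lemma splicing_finite_initials : (E.splicing q).I.Finite :=
  ((Set.finite_singleton _).insert _).union (Set.finite_range _)

lemma splicing_hasType (p : P) : (E.splicing q).HasType 2 2 := by
  have hm : E.markRule p none ∈ (E.splicing q).R := .inr ⟨(p, none), rfl⟩
  refine ⟨?_, ⟨_, hm, .inl rfl⟩, ?_, ⟨_, hm, rfl⟩⟩ <;>
    rintro r (⟨x, rfl⟩ | ⟨x, rfl⟩) <;> simp [expandRule, markRule]

end Splicing

end EmittingSystem

namespace ContextFreeGrammar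

variable {T : Type} (g : ContextFreeGrammar T)

/-- The terminals and the nonterminals that occur in `g`. -/
def usedSymbols : Set (Symbol T g.NT) :=
  insert (.nonterminal g.initial) (Set.range .terminal ∪
    ⋃ r ∈ g.rules, insert (.nonterminal r.input) {x | x ∈ r.output})

lemma finite_usedSymbols [Finite T] : g.usedSymbols.Finite :=
  ((Set.finite_range _).union (g.rules.finite_toSet.biUnion fun r _ =>
    (List.finite_toSet r.output).insert _)).insert _

lemma input_mem_usedSymbols {r : ContextFreeRule T g.NT} (hr : r ∈ g.rules) :
    .nonterminal r.input ∈ g.usedSymbols :=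
  .inr (.inr (Set.mem_biUnion (show r ∈ (g.rules : Set _) from hr) (.inl rfl)))

lemma output_mem_usedSymbols {r : ContextFreeRule T g.NT} (hr : r ∈ g.rules)
    (x : Symbol T g.NT) (hx : x ∈ r.output) : x ∈ g.usedSymbols :=
  .inr (.inr (Set.mem_biUnion (show r ∈ (g.rules : Set _) from hr) (.inr hx)))

/-- Leftmost rewriting in `g`, where a terminal on the left is emitted. An idle production for
each nonterminal ensures that every symbol can be rewritten. -/
def emitting : EmittingSystem T g.usedSymbols (g.usedSymbols ⊕ g.rules) where
  lhs
    | .inl x => x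
    | .inr r => ⟨.nonterminal r.1.input, g.input_mem_usedSymbols r.2⟩
  out
    | .inl ⟨.terminal a, _⟩ => [a]
    | _ => []
  rhs
    | .inl ⟨.terminal _, _⟩ => []
    | .inl x => [x]
    | .inr r => r.1.output.pmap Subtype.mk (g.output_mem_usedSymbols r.2)

variable {g}

lemma derives_of_gen {s : List g.usedSymbols} {w : List T} (h : g.emitting.Gen s w) :
    g.Derives (s.map Subtype.val) (w.map .terminal) := by
  induction h with
  | nil => rfl
  | @cons p s w _ ih =>
    rcases p with ⟨a | n, hx⟩ | r
    · simpa [emitting] using ih.append_left [.terminal a]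
    · simpa [emitting] using ih
    · refine Produces.trans_derives ⟨r.1, r.2, .head _⟩ ?_
      simpa [emitting, List.map_pmap] using ih

lemma gen_map_terminal (w : List T) {s : List g.usedSymbols}
    (hs : s.map Subtype.val = w.map .terminal) : g.emitting.Gen s w := by
  induction w generalizing s with
  | nil =>
    obtain rfl : s = [] := List.map_eq_nil_iff.1 hs
    exact .nil
  | cons a w ih =>
    rcases s with _ | ⟨⟨x, hx⟩, s⟩
    · simp at hs
    · simp only [List.map_cons, List.cons.injEq] at hs
      obtain ⟨rfl, hs⟩ := hs
      exact .cons (E := g.emitting) (.inl ⟨.terminal a, hx⟩) (ih hs)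

lemma gen_of_derives {u : List (Symbol T g.NT)} {w : List T}
    (h : g.Derives u (w.map .terminal)) {s : List g.usedSymbols}
    (hs : s.map Subtype.val = u) : g.emitting.Gen s w := by
  induction h using Relation.ReflTransGen.head_induction_on generalizing s with
  | refl => exact gen_map_terminal w hs
  | head hp _ ih =>
    obtain ⟨r, hr, hrw⟩ := hp
    obtain ⟨a, b, rfl, rfl⟩ := hrw.exists_parts
    rw [List.append_assoc] at hs
    obtain ⟨a', t, rfl, rfl, ht⟩ := List.map_eq_append_iff.1 hs
    obtain ⟨x, b', rfl, hx, rfl⟩ := List.map_eq_cons_iff.1 ht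
    obtain ⟨w₁, w₂, rfl, h₁, h₂⟩ := (ih (s := a' ++ (g.emitting.rhs (.inr ⟨r, hr⟩) ++ b'))
      (by simp [emitting, List.map_pmap])).split
    obtain rfl : x = g.emitting.lhs (.inr ⟨r, hr⟩) := Subtype.ext hx
    exact h₁.append (.cons _ h₂)

end ContextFreeGrammar

/-- Every non-empty `λ`-free context-free language is the image, under a homomorphism, of
the Szilard language of some labeled flat splicing system of type `(2, 2)` with finite
initial set. -/
theorem stmt14 (T : Type) [Finite T] (L : Language T)
    (hcf : Language.IsContextFree L) (hne : ∃ w, w ∈ L) (hfree : [] ∉ L) :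
    ∃ (A Λ : Type) (_ : Finite A) (_ : Finite Λ) (S : LabeledFSS A Λ) (f : Λ → List T),
      S.SzilardLabeled ∧ S.I.Finite ∧ S.HasType 2 2 ∧
      L = { w | ∃ u ∈ S.derLang, w = u.flatMap f } := by
  obtain ⟨g, rfl⟩ := hcf
  have := g.finite_usedSymbols.to_subtype
  let q : g.usedSymbols := ⟨.nonterminal g.initial, .inl rfl⟩
  refine ⟨_, _, inferInstance, (g.emitting.splicing q).finR, g.emitting.splicing q,
    fun r => g.emitting.ruleOut r.1, EmittingSystem.splicing_szilardLabeled,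
    EmittingSystem.splicing_finite_initials, EmittingSystem.splicing_hasType (.inl q), ?_⟩
  ext w
  constructor
  · intro hw
    exact (ContextFreeGrammar.gen_of_derives (s := [q]) hw rfl).exists_mem_derLang
  · rintro ⟨u, hu, rfl⟩
    exact ContextFreeGrammar.derives_of_gen
      (EmittingSystem.gen_of_mem_derLang (fun x => ⟨.inl x, rfl⟩) hu)
end

section
/- Every non-empty regular language L over a terminal alphabet T that does not contain the empty word is the control language of some labeled flat splicing system of type (1, 2) with finite initial set and label alphabet T; that is, REG \ {λ-containing languages' empty word} satisfies (REG without the empty word) ⊆ CLLS^1_{2,FIN}. -/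
namespace DFASplicing

/-- Letters of the splicing system simulating a DFA: states (with an extra final symbol
`state none`), input letters and an end marker. -/
inductive Letter (T σ : Type) : Type
  | state (q : Option σ)
  | letter (a : T)
  | marker

namespace Letter

variable {T σ : Type}

/-- The input letter carried by a symbol, if any. -/
def toInput : Letter T σ → Option T
  | letter a => some a
  | _ => none

instance [Finite T] [Finite σ] : Finite (Letter T σ) :=
  Finite.of_surjective
    (fun s : Option σ ⊕ Option T =>
      s.elim state (fun o => o.elim marker letter)) (by
    rintro (q | a | _)
    exacts [⟨.inl q, rfl⟩, ⟨.inr (some a), rfl⟩, ⟨.inr none, rfl⟩])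

end Letter

open Letter

variable {T σ : Type}

/-- The rule inserting `a c` between the state `p` and the end marker. -/
def rule (p : σ) (a : T) (c : Option σ) : FlatRule (Letter T σ) :=
  ⟨[state (some p)], [marker], [letter a], [state c]⟩

/-- A move of the automaton, where a move into an accepting state may instead stop the run. -/
def Move (M : DFA T σ) (p : σ) (a : T) (c : Option σ) : Prop :=
  c = some (M.step p a) ∨ c = none ∧ M.step p a ∈ M.accept

/-- The labeled flat splicing system simulating a DFA. -/
def system [Finite T] [Finite σ] (M : DFA T σ) : LabeledFSS (Letter T σ) T where
  I := insert [state (some M.start), marker]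
    (Set.range fun x : T × Option σ => [letter x.1, state x.2])
  R := {r | ∃ p a c, Move M p a c ∧ r = rule p a c}
  lab r := r.ins1.filterMap toInput
  finR := (Set.finite_range fun x : σ × T × Option σ => rule x.1 x.2.1 x.2.2).subset (by
    rintro _ ⟨p, a, c, -, rfl⟩
    exact ⟨(p, a, c), rfl⟩)
  insBound := by
    rintro _ ⟨p, a, c, -, rfl⟩
    simp [rule]

lemma splice_rule (z : List (Letter T σ)) (p : σ) (a : T) (c : Option σ) :
    (rule p a c).Splice (z ++ [state (some p), marker]) [letter a, state c]
      (z ++ [state (some p), letter a] ++ [state c, marker]) :=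
  ⟨z, [], [], by simp [rule]⟩

lemma eq_of_append_eq {x y z : List (Letter T σ)} {d e : Option σ} (hz : marker ∉ z)
    (h : z ++ [state d, marker] = x ++ [state e] ++ [marker] ++ y) :
    x = z ∧ e = d ∧ y = [] := by
  induction y using List.reverseRecOn with
  | nil =>
    have h' : z ++ [state d, marker] = x ++ [state e, marker] := by simpa using h
    obtain ⟨hx, hd⟩ := List.append_inj' h' rfl
    simp only [List.cons.injEq, state.injEq, and_true] at hd
    exact ⟨hx.symm, hd.symm, rfl⟩
  | append_singleton y b =>
    have h' : (z ++ [state d]) ++ [marker] = (x ++ [state e] ++ [marker] ++ y) ++ [b] := by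
      simpa using h
    have hmem : (marker : Letter T σ) ∈ z ++ [state d] := by
      rw [(List.append_inj' h' rfl).1]; simp
    simp [hz] at hmem

variable {M : DFA T σ}

/-- The last state symbol `c` of a derived word is compatible with the input `ls` read so far. -/
def Reaches (M : DFA T σ) (ls : List T) (c : Option σ) : Prop :=
  c = some (M.eval ls) ∨ c = none ∧ ls ∈ M.accepts

lemma Reaches.move {ls : List T} {p : σ} {a : T} {c : Option σ}
    (h : Reaches M ls (some p)) (hc : Move M p a c) : Reaches M (ls ++ [a]) c := by
  have hp : p = M.eval ls := by simpa [Reaches] using h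
  subst hp
  simpa [Reaches, Move, DFA.mem_accepts, ← DFA.eval_append_singleton] using hc

variable [Finite T] [Finite σ]

lemma eq_of_splice {z v w : List (Letter T σ)} {d c : Option σ} {p : σ} {a : T}
    (hz : marker ∉ z) (hv : v ∈ (system M).I)
    (h : (rule p a c).Splice (z ++ [state d, marker]) v w) :
    d = some p ∧ w = z ++ [state d, letter a] ++ [state c, marker] := by
  obtain ⟨x, y, t, hu, hvt, -, hw⟩ := h
  obtain ⟨rfl, rfl, rfl⟩ := eq_of_append_eq hz hu
  have hv' : v = [letter a, state c] := by
    rcases hv with rfl | ⟨⟨b, e⟩, rfl⟩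
    · simp [rule] at hvt
    · rcases t with _ | ⟨s, t⟩ <;> simp_all [rule]
  subst hv'
  exact ⟨rfl, by simpa [rule] using hw⟩

lemma shape_of_splice {z v w : List (Letter T σ)} {d : Option σ} {ls : List T}
    {r : FlatRule (Letter T σ)} (hz : marker ∉ z) (hd : Reaches M ls d)
    (hv : v ∈ (system M).I) (hr : r ∈ (system M).R)
    (h : r.Splice (z ++ [state d, marker]) v w) :
    ∃ z' c, marker ∉ z' ∧ w = z' ++ [state c, marker] ∧
      Reaches M (ls ++ (system M).lab r) c := by
  obtain ⟨p, a, c, hm, rfl⟩ := hr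
  obtain ⟨rfl, rfl⟩ := eq_of_splice hz hv h
  exact ⟨_, c, by simp [hz], rfl, hd.move hm⟩

lemma shape_of_deriv {w : List (Letter T σ)} {ls : List T} (h : (system M).Deriv w ls) :
    ∃ z c, marker ∉ z ∧ w = z ++ [state c, marker] ∧ Reaches M ls c := by
  induction h with
  | @start x₀ y₀ x₁ r hx hy hr hs =>
    rcases hx with rfl | ⟨⟨b, e⟩, rfl⟩
    · exact shape_of_splice (z := []) (ls := []) (by simp) (.inl rfl) hy hr hs
    · obtain ⟨p, a, c, -, rfl⟩ := hr
      obtain ⟨x, y, t, hu, -⟩ := hs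
      have hmem : (marker : Letter T σ) ∈ [letter b, state e] := by
        change [letter b, state e] = _ at hu
        rw [hu]; simp [rule]
      simp at hmem
  | step _ hy hr hs ih =>
    obtain ⟨z, c, hz, rfl, hc⟩ := ih
    exact shape_of_splice hz hc hy hr hs

lemma exists_deriv (ls : List T) {a : T} {c : Option σ} (h : Move M (M.eval ls) a c) :
    ∃ z, marker ∉ z ∧ (system M).Deriv (z ++ [state c, marker]) (ls ++ [a]) := by
  have hI : ∀ (b : T) (e : Option σ), [letter b, state e] ∈ (system M).I :=
    fun b e => .inr ⟨(b, e), rfl⟩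
  induction ls using List.reverseRecOn generalizing a c with
  | nil =>
    exact ⟨[] ++ [state (some M.start), letter a], by simp,
      .start (Set.mem_insert _ _) (hI a c) ⟨_, a, c, h, rfl⟩ (splice_rule [] M.start a c)⟩
  | append_singleton ls b ih =>
    obtain ⟨z, hz, hd⟩ := ih (a := b) (c := some (M.eval (ls ++ [b])))
      (.inl (by rw [DFA.eval_append_singleton]))
    exact ⟨z ++ [state (some (M.eval (ls ++ [b]))), letter a], by simp [hz],
      .step hd (hI a c) ⟨_, a, c, h, rfl⟩ (splice_rule z _ a c)⟩

lemma derLang_system [Nonempty T] (hM : [] ∉ M.accepts) :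
    (system M).derLang = M.accepts := by
  ext ls
  constructor
  · rintro ⟨w, hd, hterm⟩
    obtain ⟨z, c, -, rfl, rfl | ⟨-, h⟩⟩ := shape_of_deriv hd
    · obtain ⟨a⟩ := ‹Nonempty T›
      exact absurd ⟨_, ⟨_, a, _, .inl rfl, rfl⟩, _, .inr ⟨(a, _), rfl⟩, _, splice_rule _ _ _ _⟩
        hterm
    · exact h
  · intro hls
    induction ls using List.reverseRecOn with
    | nil => exact absurd hls hM
    | append_singleton ls a =>
      obtain ⟨z, hz, hd⟩ := exists_deriv (M := M) ls (a := a) (c := none)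
        (.inr ⟨rfl, by rwa [← DFA.eval_append_singleton]⟩)
      refine ⟨_, hd, ?_⟩
      rintro ⟨_, ⟨p, b, e, -, rfl⟩, v, hv, w, hs⟩
      exact absurd (eq_of_splice hz hv hs).1 (by simp)

lemma hasType_system [Nonempty T] : (system M).HasType 1 2 := by
  obtain ⟨a⟩ := ‹Nonempty T›
  have hr : rule M.start a (some (M.step M.start a)) ∈ (system M).R := ⟨_, a, _, .inl rfl, rfl⟩
  refine ⟨?_, ⟨_, hr, .inl rfl⟩, ?_, ⟨_, hr, rfl⟩⟩ <;>
  · rintro _ ⟨p, a, c, -, rfl⟩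
    simp [rule]

end DFASplicing

/-- Every non-empty `λ`-free regular language over `T` is the control language of some
labeled flat splicing system of type `(1, 2)` with finite initial set and label alphabet
`T`. -/
theorem stmt16 (T : Type) [Finite T] (L : Language T)
    (hreg : Language.IsRegular L) (hne : ∃ w, w ∈ L) (hfree : [] ∉ L) :
    ∃ (A : Type) (_ : Finite A) (S : LabeledFSS A T),
      S.ControlLabeled ∧ S.I.Finite ∧ S.HasType 1 2 ∧ S.derLang = L := by
  obtain ⟨σ, _, M, rfl⟩ := hreg
  have : Nonempty T := by
    obtain ⟨_ | ⟨a, w⟩, hw⟩ := hne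
    exacts [absurd hw hfree, ⟨a⟩]
  refine ⟨DFASplicing.Letter T σ, inferInstance, DFASplicing.system M, ?_,
    (Set.finite_range _).insert _, DFASplicing.hasType_system, DFASplicing.derLang_system hfree⟩
  rintro _ ⟨p, a, c, -, rfl⟩
  rfl
end

section
/- Every non-empty context-free language L over a terminal alphabet T that does not contain the empty word is the control language of some labeled flat splicing system of type (2, 2) with finite initial set and label alphabet T; that is, (CF without the empty word) ⊆ CLLS^2_{2,FIN}. -/
namespace ContextFreeGrammar

variable {T : Type} (g : ContextFreeGrammar T)

/-- `g.Yields α w`: the terminal word `w` is the yield of a derivation forest with roots `α`. -/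
inductive Yields : List (Symbol T g.NT) → List T → Prop
  | nil : Yields [] []
  | terminal (a : T) {β : List (Symbol T g.NT)} {v : List T} :
      Yields β v → Yields (.terminal a :: β) (a :: v)
  | nonterminal {r : ContextFreeRule T g.NT} {β : List (Symbol T g.NT)} {u v : List T} :
      r ∈ g.rules → Yields r.output u → Yields β v → Yields (.nonterminal r.input :: β) (u ++ v)

variable {g}

theorem Yields.append {α β : List (Symbol T g.NT)} {u v : List T} (hα : g.Yields α u)
    (hβ : g.Yields β v) : g.Yields (α ++ β) (u ++ v) := by
  induction hα with
  | nil => exact hβ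
  | terminal a _ ih => exact .terminal a ih
  | nonterminal hr hu _ _ ih =>
    rw [List.append_assoc]
    exact .nonterminal hr hu ih

theorem Yields.exists_of_append {α β : List (Symbol T g.NT)} {w : List T}
    (h : g.Yields (α ++ β) w) : ∃ u v, w = u ++ v ∧ g.Yields α u ∧ g.Yields β v := by
  induction α generalizing w with
  | nil => exact ⟨[], w, rfl, .nil, h⟩
  | cons X α ih =>
    rw [List.cons_append] at h
    cases h with
    | terminal a h =>
      obtain ⟨u, v, rfl, hu, hv⟩ := ih h
      exact ⟨a :: u, v, rfl, .terminal a hu, hv⟩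
    | nonterminal hr ho h =>
      obtain ⟨u, v, rfl, hu, hv⟩ := ih h
      exact ⟨_, v, (List.append_assoc ..).symm, .nonterminal hr ho hu, hv⟩

theorem Yields.of_rewrites {r : ContextFreeRule T g.NT} (hr : r ∈ g.rules)
    {α β : List (Symbol T g.NT)} (h : r.Rewrites α β) {w : List T} (hw : g.Yields β w) :
    g.Yields α w := by
  induction h generalizing w with
  | head s =>
    obtain ⟨u, v, rfl, hu, hv⟩ := hw.exists_of_append
    exact .nonterminal hr hu hv
  | cons x _ ih =>
    cases hw with
    | terminal a h => exact .terminal a (ih h)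
    | nonterminal hr' ho h => exact .nonterminal hr' ho (ih h)

theorem yields_map_terminal (w : List T) : g.Yields (w.map Symbol.terminal) w := by
  induction w with
  | nil => exact .nil
  | cons a w ih => exact .terminal a ih

theorem yields_iff_derives {α : List (Symbol T g.NT)} {w : List T} :
    g.Yields α w ↔ g.Derives α (w.map Symbol.terminal) := by
  constructor
  · intro h
    induction h with
    | nil => exact Derives.refl _
    | terminal a _ ih => exact ih.append_left [_]
    | @nonterminal r β u v hr _ _ ihu ihv =>
      have h₁ : g.Produces (.nonterminal r.input :: β) (r.output ++ β) := ⟨r, hr, .head β⟩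
      rw [List.map_append]
      exact h₁.trans_derives ((ihu.append_right β).trans (ihv.append_left _))
  · intro h
    induction h using Relation.ReflTransGen.head_induction_on with
    | refl => exact yields_map_terminal w
    | head h _ ih =>
      obtain ⟨r, hr, h⟩ := h
      exact ih.of_rewrites hr h

variable (g)

/-- The sentential forms occurring inside the start word or a right-hand side of `g`. -/
def factors : Set (List (Symbol T g.NT)) :=
  {α | α <:+: [.nonterminal g.initial] ∨ ∃ r ∈ g.rules, α <:+: r.output}

variable {g}

theorem mem_factors_of_isInfix {α β : List (Symbol T g.NT)} (h : α <:+: β) (hβ : β ∈ g.factors) :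
    α ∈ g.factors := by
  rcases hβ with hβ | ⟨r, hr, hβ⟩
  · exact Or.inl (h.trans hβ)
  · exact Or.inr ⟨r, hr, h.trans hβ⟩

theorem finite_setOf_isInfix {X : Type*} (l : List X) : {l' | l' <:+: l}.Finite :=
  (List.finite_toSet l.sublists).subset fun _ h => List.mem_sublists.2 h.sublist

theorem finite_factors : g.factors.Finite := by
  refine ((finite_setOf_isInfix [Symbol.nonterminal g.initial]).union
    (g.rules.finite_toSet.biUnion fun r _ => finite_setOf_isInfix r.output)).subset ?_
  rintro α (h | ⟨r, hr, h⟩)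
  · exact Or.inl h
  · exact Or.inr (Set.mem_biUnion hr h)

/-- The words yielded by a sentential form. -/
def yieldLang (α : List (Symbol T g.NT)) : Language T := {w | g.Yields α w}

theorem mem_yieldLang {α : List (Symbol T g.NT)} {w : List T} :
    w ∈ yieldLang α ↔ g.Yields α w := Iff.rfl

theorem Yields.exists_split {α : List (Symbol T g.NT)} {w : List T} (h : g.Yields α w)
    (hα : α ∈ g.factors) (hw : 2 ≤ w.length) :
    ∃ β ∈ g.factors, ∃ γ ∈ g.factors, ∃ u ∈ yieldLang β, ∃ v ∈ yieldLang γ,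
      u ≠ [] ∧ v ≠ [] ∧ w = u ++ v ∧ yieldLang β * yieldLang γ ≤ yieldLang α := by
  induction h with
  | nil => simp at hw
  | @terminal a β v h _ =>
    refine ⟨[.terminal a], mem_factors_of_isInfix ⟨[], β, rfl⟩ hα, β,
      mem_factors_of_isInfix (List.suffix_cons _ β).isInfix hα, [a], .terminal a .nil, v, h, by simp, ?_, rfl, ?_⟩
    · rintro rfl
      simp at hw
    · intro x hx
      obtain ⟨y, hy, z, hz, rfl⟩ := Language.mem_mul.1 hx
      exact Yields.append hy hz
  | @nonterminal r β u v hr hu hv ihu ihv =>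
    have hβ : β ∈ g.factors := mem_factors_of_isInfix (List.suffix_cons _ β).isInfix hα
    rcases eq_or_ne u [] with rfl | hu'
    · obtain ⟨β₁, h₁, β₂, h₂, x, hx, y, hy, hx', hy', he, hle⟩ := ihv hβ hw
      exact ⟨β₁, h₁, β₂, h₂, x, hx, y, hy, hx', hy', he,
        hle.trans fun z hz => Yields.nonterminal hr hu hz⟩
    rcases eq_or_ne v [] with rfl | hv'
    · rw [List.append_nil] at hw ⊢
      obtain ⟨β₁, h₁, β₂, h₂, x, hx, y, hy, hx', hy', he, hle⟩ :=
        ihu (Or.inr ⟨r, hr, List.infix_rfl⟩) hw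
      refine ⟨β₁, h₁, β₂, h₂, x, hx, y, hy, hx', hy', he, hle.trans fun z hz => ?_⟩
      have := Yields.nonterminal hr hz hv
      rwa [List.append_nil] at this
    · refine ⟨[.nonterminal r.input], mem_factors_of_isInfix ⟨[], β, rfl⟩ hα, β, hβ, u, ?_, v, hv,
        hu', hv', rfl, ?_⟩
      · simpa [mem_yieldLang] using Yields.nonterminal hr hu .nil
      · intro x hx
        obtain ⟨y, hy, z, hz, rfl⟩ := Language.mem_mul.1 hx
        exact Yields.append hy hz

end ContextFreeGrammar

/-- A semantic Chomsky normal form: a context-free language belongs to a finite family of languages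
in which every word of length at least two splits along a product of two members. -/
theorem Language.IsContextFree.exists_binary_family {T : Type} {L : Language T}
    (h : L.IsContextFree) :
    ∃ (N : Type) (_ : Finite N) (ℓ : N → Language T) (s : N), ℓ s = L ∧
      ∀ A, ∀ w ∈ ℓ A, 2 ≤ w.length → ∃ B C, ∃ u ∈ ℓ B, ∃ v ∈ ℓ C,
        u ≠ [] ∧ v ≠ [] ∧ w = u ++ v ∧ ℓ B * ℓ C ≤ ℓ A := by
  obtain ⟨g, rfl⟩ := h
  refine ⟨g.factors, ContextFreeGrammar.finite_factors.to_subtype,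
    fun α => ContextFreeGrammar.yieldLang α.1,
    ⟨[.nonterminal g.initial], Or.inl List.infix_rfl⟩, ?_, ?_⟩
  · ext w
    exact ContextFreeGrammar.yields_iff_derives
  · rintro ⟨α, hα⟩ w hw hlen
    obtain ⟨β, hβ, γ, hγ, h⟩ := ContextFreeGrammar.Yields.exists_split hw hα hlen
    exact ⟨⟨β, hβ⟩, ⟨γ, hγ⟩, h⟩

section LeftCorner

variable {T N : Type} (ℓ : N → Language T)

/-- `LeftCorner ℓ A B w`: the word `w` completes a left corner `B` to an `A`. -/
inductive LeftCorner (A : N) : N → List T → Prop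
  | refl : LeftCorner A A []
  | step {B C D : N} {v x : List T} : ℓ B * ℓ C ≤ ℓ D → v ∈ ℓ C → v ≠ [] →
      LeftCorner A D x → LeftCorner A B (v ++ x)

variable {ℓ}

theorem LeftCorner.append_mem {A B : N} {w u : List T} (h : LeftCorner ℓ A B w) (hu : u ∈ ℓ B) :
    u ++ w ∈ ℓ A := by
  induction h generalizing u with
  | refl => simpa using hu
  | step hle hv _ _ ih =>
    rw [← List.append_assoc]
    exact ih (hle (Language.append_mem_mul hu hv))

theorem LeftCorner.append_right {A B C E : N} {u v : List T} (h : LeftCorner ℓ B E u)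
    (hle : ℓ B * ℓ C ≤ ℓ A) (hv : v ∈ ℓ C) (hv' : v ≠ []) : LeftCorner ℓ A E (u ++ v) := by
  induction h with
  | refl => simpa using LeftCorner.step hle hv hv' .refl
  | step hle' hx hx' _ ih =>
    rw [List.append_assoc]
    exact .step hle' hx hx' ih

theorem LeftCorner.exists_of_mem
    (hℓ : ∀ A, ∀ w ∈ ℓ A, 2 ≤ w.length → ∃ B C, ∃ u ∈ ℓ B, ∃ v ∈ ℓ C,
      u ≠ [] ∧ v ≠ [] ∧ w = u ++ v ∧ ℓ B * ℓ C ≤ ℓ A)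
    {A : N} {w : List T} (hw : w ∈ ℓ A) (hne : w ≠ []) :
    ∃ a w' E, w = a :: w' ∧ [a] ∈ ℓ E ∧ LeftCorner ℓ A E w' := by
  induction hn : w.length using Nat.strong_induction_on generalizing A w with
  | _ n ih =>
    subst hn
    match w, hne with
    | [a], _ => exact ⟨a, [], A, rfl, hw, .refl⟩
    | b :: c :: w, _ =>
      obtain ⟨B, C, u, hu, v, hv, hu', hv', he, hle⟩ := hℓ A _ hw (by simp)
      have hlt : u.length < (b :: c :: w).length := by
        have := List.length_pos_of_ne_nil hv'
        rw [he, List.length_append]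
        omega
      obtain ⟨a, u', E, rfl, ha, hE⟩ := ih _ hlt hu hu' rfl
      exact ⟨a, u' ++ v, E, by simpa using he, ha, hE.append_right hle hv hv'⟩

/-- Nonterminals of the Greibach normal form obtained from left corners; `stuck` generates
no word. -/
inductive LeftCornerSymbol (N : Type)
  | start
  | corner (A B : N)
  | stuck

instance [Finite N] : Finite (LeftCornerSymbol N) := by
  refine Finite.of_surjective
    (fun x : Bool ⊕ N × N => Sum.elim (fun b => bif b then LeftCornerSymbol.start else .stuck)
      (fun p => .corner p.1 p.2) x) ?_
  rintro (_ | ⟨A, B⟩ | _)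
  · exact ⟨.inl true, rfl⟩
  · exact ⟨.inr (A, B), rfl⟩
  · exact ⟨.inl false, rfl⟩

namespace LeftCornerSymbol

/-- `γ` is the nonterminal `corner A B`, which may be omitted when `A = B`. -/
def Optional (A B : N) (γ : List (LeftCornerSymbol N)) : Prop :=
  γ = [corner A B] ∨ A = B ∧ γ = []

variable (ℓ)

/-- Productions `q → a γ` of the left-corner Greibach normal form with start language `ℓ s`. -/
def Production (s : N) : LeftCornerSymbol N → T → List (LeftCornerSymbol N) → Prop
  | start, a, γ => γ = [stuck] ∨ ∃ E, [a] ∈ ℓ E ∧ Optional s E γ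
  | corner A B, a, γ => γ = [stuck] ∨ ∃ C D E, ℓ B * ℓ C ≤ ℓ D ∧ [a] ∈ ℓ E ∧
      ∃ γ₁ γ₂, Optional C E γ₁ ∧ Optional A D γ₂ ∧ γ = γ₁ ++ γ₂
  | stuck, _, γ => γ = [stuck]

/-- The language generated by a nonterminal of the left-corner grammar. -/
def lang (s : N) : LeftCornerSymbol N → Language T
  | start => ℓ s
  | corner A B => {w | LeftCorner ℓ A B w}
  | stuck => 0

variable {ℓ}

theorem Optional.length_le {A B : N} {γ : List (LeftCornerSymbol N)} (h : Optional A B γ) :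
    γ.length ≤ 1 := by
  rcases h with rfl | ⟨_, rfl⟩ <;> simp

theorem Optional.leftCorner {s A B : N} {γ : List (LeftCornerSymbol N)} (h : Optional A B γ)
    {w : List T} (hw : w ∈ (γ.map (lang ℓ s)).prod) : LeftCorner ℓ A B w := by
  rcases h with rfl | ⟨rfl, rfl⟩
  · have : w ∈ lang ℓ s (corner A B) := by simpa using hw
    exact this
  · have : w = [] := by simpa using hw
    exact this ▸ .refl

theorem Production.length_le {s : N} {q : LeftCornerSymbol N} {a : T}
    {γ : List (LeftCornerSymbol N)} (h : Production ℓ s q a γ) : γ.length ≤ 2 := by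
  cases q with
  | start =>
    rcases h with rfl | ⟨E, -, h⟩
    · simp
    · exact h.length_le.trans one_le_two
  | corner A B =>
    rcases h with rfl | ⟨C, D, E, -, -, γ₁, γ₂, h₁, h₂, rfl⟩
    · simp
    · have := h₁.length_le
      have := h₂.length_le
      rw [List.length_append]
      omega
  | stuck =>
    obtain rfl : γ = [stuck] := h
    simp

theorem stuck_production (s : N) (q : LeftCornerSymbol N) (a : T) :
    Production ℓ s q a [stuck] := by
  cases q
  exacts [Or.inl rfl, Or.inl rfl, rfl]

theorem Production.cons_mem {s : N} {q : LeftCornerSymbol N} {a : T}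
    {γ : List (LeftCornerSymbol N)} (h : Production ℓ s q a γ) {w : List T}
    (hw : w ∈ (γ.map (lang ℓ s)).prod) : a :: w ∈ lang ℓ s q := by
  have hstuck : γ ≠ [stuck] := by
    rintro rfl
    simp [lang] at hw
  cases q with
  | start =>
    rcases h with h | ⟨E, ha, h⟩
    · exact absurd h hstuck
    · exact (h.leftCorner hw).append_mem ha
  | corner A B =>
    rcases h with h | ⟨C, D, E, hle, ha, γ₁, γ₂, h₁, h₂, rfl⟩
    · exact absurd h hstuck
    · rw [List.map_append, List.prod_append, Language.mem_mul] at hw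
      obtain ⟨u, hu, v, hv, rfl⟩ := hw
      exact LeftCorner.step (v := a :: u) hle ((h₁.leftCorner hu).append_mem ha) (by simp)
        (h₂.leftCorner hv)
  | stuck => exact absurd h hstuck

end LeftCornerSymbol

end LeftCorner

section Greibach

variable {T Q : Type} (P : Q → T → List Q → Prop)

/-- Leftmost derivations of a grammar in Greibach normal form with productions `q → a γ`. -/
inductive GreibachYields : List Q → List T → Prop
  | nil : GreibachYields [] []
  | cons {q : Q} {a : T} {γ σ : List Q} {w : List T} :
      P q a γ → GreibachYields (γ ++ σ) w → GreibachYields (q :: σ) (a :: w)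

variable {P}

theorem GreibachYields.append {σ τ : List Q} {u v : List T} (hσ : GreibachYields P σ u)
    (hτ : GreibachYields P τ v) : GreibachYields P (σ ++ τ) (u ++ v) := by
  induction hσ with
  | nil => exact hτ
  | cons hP _ ih => exact .cons hP (by simpa using ih)

end Greibach

namespace LeftCornerSymbol

variable {T N : Type} {ℓ : N → Language T} {s : N}

theorem mem_prod_of_greibachYields {σ : List (LeftCornerSymbol N)} {w : List T}
    (h : GreibachYields (Production ℓ s) σ w) : w ∈ (σ.map (lang ℓ s)).prod := by
  induction h with
  | nil => simp
  | @cons q a γ σ w hP _ ih =>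
    rw [List.map_append, List.prod_append, Language.mem_mul] at ih
    obtain ⟨u, hu, v, hv, rfl⟩ := ih
    rw [List.map_cons, List.prod_cons]
    exact Language.append_mem_mul (hP.cons_mem hu) hv

theorem exists_optional_greibachYields {A B : N} {w : List T} (h : LeftCorner ℓ A B w)
    (hw : w ≠ [] → GreibachYields (Production ℓ s) [corner A B] w) :
    ∃ γ, Optional A B γ ∧ GreibachYields (Production ℓ s) γ w := by
  cases h with
  | refl => exact ⟨[], Or.inr ⟨rfl, rfl⟩, .nil⟩
  | step _ _ hv _ => exact ⟨_, Or.inl rfl, hw (by simp [hv])⟩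

theorem greibachYields_corner
    (hℓ : ∀ A, ∀ w ∈ ℓ A, 2 ≤ w.length → ∃ B C, ∃ u ∈ ℓ B, ∃ v ∈ ℓ C,
      u ≠ [] ∧ v ≠ [] ∧ w = u ++ v ∧ ℓ B * ℓ C ≤ ℓ A)
    {A B : N} {w : List T} (h : LeftCorner ℓ A B w) (hw : w ≠ []) :
    GreibachYields (Production ℓ s) [corner A B] w := by
  induction hn : w.length using Nat.strong_induction_on generalizing A B w with
  | _ n ih =>
    subst hn
    cases h with
    | refl => exact absurd rfl hw
    | @step B C D v x hle hv hv' hx =>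
      obtain ⟨a, v', E, rfl, ha, hE⟩ := LeftCorner.exists_of_mem hℓ hv hv'
      obtain ⟨γ₁, h₁, hy₁⟩ := exists_optional_greibachYields (s := s) hE
        fun h => ih _ (by simp) hE h rfl
      obtain ⟨γ₂, h₂, hy₂⟩ := exists_optional_greibachYields (s := s) hx
        fun h => ih _ (by simp) hx h rfl
      exact .cons (Or.inr ⟨C, D, E, hle, ha, γ₁, γ₂, h₁, h₂, rfl⟩) (by simpa using hy₁.append hy₂)

theorem greibachYields_start_iff
    (hℓ : ∀ A, ∀ w ∈ ℓ A, 2 ≤ w.length → ∃ B C, ∃ u ∈ ℓ B, ∃ v ∈ ℓ C,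
      u ≠ [] ∧ v ≠ [] ∧ w = u ++ v ∧ ℓ B * ℓ C ≤ ℓ A) (hs : [] ∉ ℓ s) {w : List T} :
    GreibachYields (Production ℓ s) [start] w ↔ w ∈ ℓ s := by
  constructor
  · intro h
    simpa [lang] using mem_prod_of_greibachYields h
  · intro h
    obtain ⟨a, w', E, rfl, ha, hE⟩ :=
      LeftCorner.exists_of_mem hℓ h (ne_of_mem_of_not_mem h hs)
    obtain ⟨γ, hγ, hy⟩ := exists_optional_greibachYields (s := s) hE (greibachYields_corner hℓ hE)
    exact .cons (Or.inr ⟨E, ha, hγ⟩) (by simpa using hy)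

end LeftCornerSymbol

/-- Every `λ`-free context-free language has a grammar in Greibach normal form whose productions
have at most two nonterminals on the right, and in which every nonterminal has a production. -/
theorem Language.IsContextFree.exists_greibach {T : Type} [Nonempty T] {L : Language T}
    (h : L.IsContextFree) (hL : [] ∉ L) :
    ∃ (Q : Type) (_ : Finite Q) (P : Q → T → List Q → Prop) (s : Q),
      (∀ q a γ, P q a γ → γ.length ≤ 2) ∧ (∀ q, ∃ a γ, P q a γ) ∧
      ∀ w, GreibachYields P [s] w ↔ w ∈ L := by
  obtain ⟨N, _, ℓ, s, rfl, hℓ⟩ := h.exists_binary_family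
  obtain ⟨a⟩ := ‹Nonempty T›
  exact ⟨LeftCornerSymbol N, inferInstance, LeftCornerSymbol.Production ℓ s, .start,
    fun _ _ _ => LeftCornerSymbol.Production.length_le,
    fun q => ⟨a, _, LeftCornerSymbol.stuck_production s q a⟩,
    fun _ => LeftCornerSymbol.greibachYields_start_iff hℓ hL⟩

/-- Letters of the splicing system simulating a grammar in Greibach normal form. -/
inductive StackLetter (T Q : Type)
  | marker (m : Option (T × {γ : List Q // γ.length ≤ 2}))
  | stack (q : Q)
  | bottom

namespace StackLetter

variable {T Q : Type}

instance [Finite T] [Finite Q] : Finite (StackLetter T Q) := by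
  have : Finite {γ : List Q // γ.length ≤ 2} := (List.finite_length_le Q 2).to_subtype
  refine Finite.of_surjective
    (fun x : Option (T × {γ : List Q // γ.length ≤ 2}) ⊕ Option Q =>
      Sum.elim StackLetter.marker (fun o => o.elim StackLetter.bottom StackLetter.stack) x) ?_
  rintro (m | q | _)
  · exact ⟨.inl m, rfl⟩
  · exact ⟨.inr (some q), rfl⟩
  · exact ⟨.inr none, rfl⟩

/-- The letter is not a marker. -/
def Plain (x : StackLetter T Q) : Prop := ∀ m, x ≠ marker m

/-- The encoding of a stack, with two bottom letters. -/
def encode (σ : List Q) : List (StackLetter T Q) := σ.map stack ++ [bottom, bottom]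

theorem plain_of_mem_encode {σ : List Q} {x : StackLetter T Q} (h : x ∈ encode σ) : x.Plain := by
  rintro m rfl
  simp [encode] at h

/-- The consumed part of a configuration: a sequence of blocks `marker m, stack q`. -/
inductive Consumed : List (StackLetter T Q) → Prop
  | nil : Consumed []
  | cons (m) (q : Q) {p : List (StackLetter T Q)} :
      Consumed p → Consumed (marker m :: stack q :: p)

theorem Consumed.append_block {p : List (StackLetter T Q)} (h : Consumed p) (m) (q : Q) :
    Consumed (p ++ [marker m, stack q]) := by
  induction h with
  | nil => exact .cons m q .nil
  | cons m' q' _ ih => exact .cons m' q' ih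

/-- In a configuration, a marker followed by a stack letter and a plain letter is the current one. -/
theorem Consumed.eq_of_config_eq {p x y : List (StackLetter T Q)} (hp : Consumed p) {m m'} {q : Q}
    {b : StackLetter T Q} (hb : b.Plain) {σ : List Q}
    (h : p ++ marker m :: encode σ = x ++ marker m' :: stack q :: b :: y) :
    x = p ∧ m' = m ∧ ∃ τ, σ = q :: τ ∧ b :: y = encode τ := by
  induction hp generalizing x with
  | nil =>
    match x with
    | [] =>
      simp only [List.nil_append, List.cons.injEq, marker.injEq] at h
      obtain ⟨rfl, h⟩ := h
      cases σ with
      | nil => simp [encode] at h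
      | cons q' τ =>
        simp only [encode, List.map_cons, List.cons_append, List.cons.injEq, stack.injEq] at h
        obtain ⟨rfl, h⟩ := h
        exact ⟨rfl, rfl, τ, rfl, h.symm⟩
    | c :: x =>
      simp only [List.nil_append, List.cons_append, List.cons.injEq] at h
      exact absurd rfl (plain_of_mem_encode (σ := σ) (by rw [h.2]; simp) m')
  | @cons n r p hp ih =>
    match x with
    | [] =>
      simp only [List.nil_append, List.cons_append, List.cons.injEq] at h
      cases hp with
      | nil =>
        simp only [List.nil_append, List.cons.injEq] at h
        exact absurd h.2.2.1.symm (hb _)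
      | cons =>
        simp only [List.cons_append, List.cons.injEq] at h
        exact absurd h.2.2.1.symm (hb _)
    | [c] => simp at h
    | c :: d :: x =>
      simp only [List.cons_append, List.cons.injEq] at h
      obtain ⟨rfl, rfl, h⟩ := h
      obtain ⟨rfl, h'⟩ := ih h
      exact ⟨rfl, h'⟩

end StackLetter

/-- `⟨marker m, stack q | marker (a, γ) − | x, y⟩`, which pops `q`, pushes `γ` and emits `a`. -/
def popRule {T Q : Type} (m : Option (T × {γ : List Q // γ.length ≤ 2})) (q : Q)
    (x y : StackLetter T Q) (c : T × {γ : List Q // γ.length ≤ 2}) : FlatRule (StackLetter T Q) :=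
  ⟨[.marker m, .stack q], [x, y], [.marker (some c)], []⟩

/-- The rule `⟨bottom, bottom | bottom − bottom | λ⟩`, which is never applicable. -/
def idleRule (T Q : Type) : FlatRule (StackLetter T Q) :=
  ⟨[.bottom, .bottom], [], [.bottom], [.bottom]⟩

/-- The word inserted when the production with right-hand side `a γ` is applied. -/
def pushWord {T Q : Type} (c : T × {γ : List Q // γ.length ≤ 2}) : List (StackLetter T Q) :=
  .marker (some c) :: c.2.1.map .stack

/-- The label of a rule, read off the marker it inserts. -/
def emitted {T Q : Type} (t₀ : T) (r : FlatRule (StackLetter T Q)) : List T :=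
  match r.ins1 with
  | [.marker (some c)] => [c.1]
  | _ => [t₀]

/-- The labeled flat splicing system simulating leftmost derivations of a grammar in Greibach
normal form. -/
def stackFSS {T Q : Type} [Finite T] [Finite Q] (P : Q → T → List Q → Prop) (s : Q) (t₀ : T) :
    LabeledFSS (StackLetter T Q) T where
  I := insert (.marker none :: StackLetter.encode [s]) (Set.range pushWord)
  R := insert (idleRule T Q)
    {r | ∃ m q x y c, x.Plain ∧ y.Plain ∧ P q c.1 c.2.1 ∧ r = popRule m q x y c}
  lab := emitted t₀
  finR := by
    have : Finite {γ : List Q // γ.length ≤ 2} := (List.finite_length_le Q 2).to_subtype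
    refine Set.Finite.insert _ ((Set.finite_range
      fun z : Option (T × {γ : List Q // γ.length ≤ 2}) × Q × StackLetter T Q × StackLetter T Q ×
        (T × {γ : List Q // γ.length ≤ 2}) =>
        popRule z.1 z.2.1 z.2.2.1 z.2.2.2.1 z.2.2.2.2).subset ?_)
    rintro r ⟨m, q, x, y, c, -, -, -, rfl⟩
    exact ⟨(m, q, x, y, c), rfl⟩
  insBound := by
    rintro r (rfl | ⟨m, q, x, y, c, -, -, -, rfl⟩) <;> simp [idleRule, popRule]

namespace stackFSS

open StackLetter

variable {T Q : Type} [Finite T] [Finite Q] {P : Q → T → List Q → Prop} {s : Q} {t₀ : T}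

theorem finite_I : (stackFSS P s t₀).I.Finite := by
  have : Finite {γ : List Q // γ.length ≤ 2} := (List.finite_length_le Q 2).to_subtype
  exact (Set.finite_range _).insert _

theorem controlLabeled : (stackFSS P s t₀).ControlLabeled := by
  rintro r (rfl | ⟨m, q, x, y, c, -, -, -, rfl⟩) <;> rfl

theorem hasType : (stackFSS P s t₀).HasType 2 2 := by
  refine ⟨?_, ⟨idleRule T Q, Or.inl rfl, Or.inl rfl⟩, ?_, ⟨idleRule T Q, Or.inl rfl, rfl⟩⟩ <;>
    rintro r (rfl | ⟨m, q, x, y, c, -, -, -, rfl⟩) <;> simp [idleRule, popRule]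

/-- The only splicings of the system pop a stack letter and push the right-hand side of one of
its productions. -/
theorem splice_cases {r : FlatRule (StackLetter T Q)} (hr : r ∈ (stackFSS P s t₀).R)
    {u v w : List (StackLetter T Q)} (hv : v ∈ (stackFSS P s t₀).I) (h : r.Splice u v w) :
    ∃ m q b₁ b₂ c z₁ z₂, b₁.Plain ∧ P q c.1 c.2.1 ∧ r = popRule m q b₁ b₂ c ∧
      u = z₁ ++ marker m :: stack q :: b₁ :: b₂ :: z₂ ∧
      w = z₁ ++ marker m :: stack q :: (pushWord c ++ b₁ :: b₂ :: z₂) := by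
  obtain ⟨x, y, z, rfl, hv', -, rfl⟩ := h
  rcases hr with rfl | ⟨m, q, b₁, b₂, c, h₁, -, hP, rfl⟩
  · rcases hv with rfl | ⟨c, rfl⟩ <;> simp [idleRule, pushWord] at hv'
  · refine ⟨m, q, b₁, b₂, c, x, y, h₁, hP, rfl, by simp [popRule], ?_⟩
    rcases hv with rfl | ⟨c', rfl⟩
    · simp [popRule] at hv'
    · obtain rfl : c' = c := by
        simp only [pushWord, popRule, List.cons_append, List.cons.injEq, marker.injEq,
          Option.some.injEq] at hv'
        exact hv'.1
      simp [popRule]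

theorem splice_config {r : FlatRule (StackLetter T Q)} (hr : r ∈ (stackFSS P s t₀).R)
    {p v w : List (StackLetter T Q)} {m} {σ : List Q} (hp : Consumed p)
    (hv : v ∈ (stackFSS P s t₀).I) (h : r.Splice (p ++ marker m :: encode σ) v w) :
    ∃ p' m' q τ a γ, Consumed p' ∧ σ = q :: τ ∧ P q a γ ∧ emitted t₀ r = [a] ∧
      w = p' ++ marker m' :: encode (γ ++ τ) := by
  obtain ⟨m', q, b₁, b₂, c, z₁, z₂, hb, hP, rfl, hu, rfl⟩ := splice_cases hr hv h
  obtain ⟨rfl, rfl, τ, rfl, he⟩ := hp.eq_of_config_eq hb hu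
  refine ⟨_, some c, q, τ, c.1, c.2.1, hp.append_block m' q, rfl, hP, rfl, ?_⟩
  rw [he]
  simp [pushWord, encode]

theorem exists_splice (hP2 : ∀ q a γ, P q a γ → γ.length ≤ 2) {q : Q} {a : T} {γ : List Q}
    (hP : P q a γ) {p : List (StackLetter T Q)} (hp : Consumed p) (m) (τ : List Q) :
    ∃ r ∈ (stackFSS P s t₀).R, ∃ v ∈ (stackFSS P s t₀).I, ∃ p' m', Consumed p' ∧
      emitted t₀ r = [a] ∧
      r.Splice (p ++ marker m :: encode (q :: τ)) v (p' ++ marker m' :: encode (γ ++ τ)) := by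
  obtain ⟨b₁, b₂, z, hz⟩ : ∃ b₁ b₂ z, encode (T := T) τ = b₁ :: b₂ :: z := by
    match τ with
    | [] => exact ⟨_, _, _, rfl⟩
    | [_] => exact ⟨_, _, _, rfl⟩
    | _ :: _ :: _ => exact ⟨_, _, _, rfl⟩
  have hpl (b) (hb : b ∈ b₁ :: b₂ :: z) : b.Plain := plain_of_mem_encode (hz ▸ hb)
  let c : T × {γ : List Q // γ.length ≤ 2} := (a, ⟨γ, hP2 q a γ hP⟩)
  refine ⟨popRule m q b₁ b₂ c, Or.inr ⟨m, q, b₁, b₂, c, hpl _ (by simp), hpl _ (by simp), hP, rfl⟩,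
    pushWord c, Or.inr ⟨c, rfl⟩, p ++ [marker m, stack q], some c, hp.append_block m q, rfl,
    p, z, γ.map stack, ?_, ?_, ?_, ?_⟩
  · have : encode (T := T) (q :: τ) = stack q :: encode τ := rfl
    simp [popRule, this, hz]
  · simp [popRule, pushWord, c]
  · simp [pushWord]
  · have : encode (T := T) (γ ++ τ) = γ.map stack ++ encode τ := by simp [encode]
    simp [popRule, pushWord, this, hz, c]

theorem exists_config_of_deriv {x : List (StackLetter T Q)} {ls : List T}
    (h : (stackFSS P s t₀).Deriv x ls) :
    ∃ p m σ, Consumed p ∧ x = p ++ marker m :: encode σ ∧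
      ∀ w, GreibachYields P σ w → GreibachYields P [s] (ls ++ w) := by
  induction h with
  | @start x₀ y₀ x₁ r hx hy hr h =>
    rcases hx with rfl | ⟨c, rfl⟩
    · obtain ⟨p, m, q, τ, a, γ, hp, hσ, hP, he, rfl⟩ := splice_config (p := []) hr .nil hy h
      refine ⟨p, m, γ ++ τ, hp, rfl, fun w hw => ?_⟩
      change GreibachYields P [s] (emitted t₀ r ++ w)
      rw [hσ, he]
      exact .cons hP hw
    · obtain ⟨m, q, b₁, b₂, c', z₁, z₂, -, -, -, hu, -⟩ := splice_cases hr hy h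
      have := congrArg List.length hu
      have := c.2.2
      simp only [pushWord, List.length_append, List.length_cons, List.length_map] at *
      omega
  | @step x y w ls r _ hy hr h ih =>
    obtain ⟨p, m, σ, hp, rfl, hσ⟩ := ih
    obtain ⟨p', m', q, τ, a, γ, hp', rfl, hP, he, rfl⟩ := splice_config hr hp hy h
    refine ⟨p', m', γ ++ τ, hp', rfl, fun w hw => ?_⟩
    change GreibachYields P [s] (ls ++ emitted t₀ r ++ w)
    rw [he, List.append_assoc]
    exact hσ _ (.cons hP hw)

theorem not_applicable_nil {p : List (StackLetter T Q)} (hp : Consumed p) (m) :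
    ¬ (stackFSS P s t₀).Applicable (p ++ marker m :: encode []) := by
  rintro ⟨r, hr, v, hv, w, h⟩
  obtain ⟨-, -, q, τ, -, -, -, h, -⟩ := splice_config hr hp hv h
  exact absurd h (by simp)

theorem mem_derLang_of_deriv (hP2 : ∀ q a γ, P q a γ → γ.length ≤ 2) {σ : List Q} {w : List T}
    (h : GreibachYields P σ w) {p : List (StackLetter T Q)} (hp : Consumed p) {m} {ls : List T}
    (hd : (stackFSS P s t₀).Deriv (p ++ marker m :: encode σ) ls) :
    ls ++ w ∈ (stackFSS P s t₀).derLang := by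
  induction h generalizing p m ls with
  | nil => exact ⟨_, by simpa using hd, not_applicable_nil hp m⟩
  | @cons q a γ σ w hP _ ih =>
    obtain ⟨r, hr, v, hv, p', m', hp', he, h⟩ := exists_splice hP2 hP hp m σ
    have := ih hp' (.step hd hv hr h)
    change ls ++ emitted t₀ r ++ w ∈ _ at this
    simpa [he] using this

theorem mem_derLang_iff (hP2 : ∀ q a γ, P q a γ → γ.length ≤ 2) (hP' : ∀ q, ∃ a γ, P q a γ)
    {w : List T} : w ∈ (stackFSS P s t₀).derLang ↔ GreibachYields P [s] w := by
  constructor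
  · rintro ⟨x, hd, hx⟩
    obtain ⟨p, m, σ, hp, rfl, hσ⟩ := exists_config_of_deriv hd
    cases σ with
    | nil => simpa using hσ [] .nil
    | cons q τ =>
      obtain ⟨a, γ, hP⟩ := hP' q
      obtain ⟨r, hr, v, hv, _, _, -, -, h⟩ := exists_splice hP2 hP hp m τ
      exact absurd ⟨r, hr, v, hv, _, h⟩ hx
  · intro h
    cases h with
    | @cons _ a γ _ w hP h =>
      obtain ⟨r, hr, v, hv, p', m', hp', he, hs⟩ :=
        exists_splice (s := s) (t₀ := t₀) hP2 hP .nil none []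
      have := mem_derLang_of_deriv hP2 h hp' (.start (Or.inl rfl) hv hr hs)
      change emitted t₀ r ++ w ∈ _ at this
      simpa [he] using this

end stackFSS

/-- Every non-empty `λ`-free context-free language over `T` is the control language of
some labeled flat splicing system of type `(2, 2)` with finite initial set and label
alphabet `T`. -/
theorem stmt17 (T : Type) [Finite T] (L : Language T)
    (hcf : Language.IsContextFree L) (hne : ∃ w, w ∈ L) (hfree : [] ∉ L) :
    ∃ (A : Type) (_ : Finite A) (S : LabeledFSS A T),
      S.ControlLabeled ∧ S.I.Finite ∧ S.HasType 2 2 ∧ S.derLang = L := by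
  obtain ⟨t₀⟩ : Nonempty T := by
    obtain ⟨w, hw⟩ := hne
    cases w with
    | nil => exact absurd hw hfree
    | cons a _ => exact ⟨a⟩
  have : Nonempty T := ⟨t₀⟩
  obtain ⟨Q, _, P, s, hP2, hP, hL⟩ := hcf.exists_greibach hfree
  refine ⟨StackLetter T Q, inferInstance, stackFSS P s t₀, stackFSS.controlLabeled,
    stackFSS.finite_I, stackFSS.hasType, ?_⟩
  ext w
  rw [stackFSS.mem_derLang_iff hP2 hP, hL]
end
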